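/- arXiv:1401.0285 — 6 statements merged into one kernel-verified Lean document; each statement's English description precedes it below -/
import Mathlib

section
/- Let ε > 0, let u : ℝ × [0,∞) → ℝ be continuous and bounded with t ↦ u(·,t) a continuous curve in C_b(ℝ), and let X be a solution of the discrete transport ODE with velocity u and step ε with initial value v₀ ∈ C_b(ℝ). If u(x+2π,t) = u(x,t) for all x,t and v₀(x+2π) = v₀(x) for all x, then X(x+2π,t) = X(x,t) for all x ∈ ℝ and all t ≥ 0. -/
open MeasureTheory Set Real

/-- `X : [0,∞) → C_b(ℝ)` is a continuously differentiable solution of the discrete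
transport ODE with velocity `u` (written `u x t`) and step `ε`. -/
def IsDiscreteTransportSol (ε : ℝ) (u : ℝ → ℝ → ℝ)
    (X : ℝ → BoundedContinuousFunction ℝ ℝ) : Prop :=
  ∃ X' : ℝ → BoundedContinuousFunction ℝ ℝ,
    ContinuousOn X' (Ici 0) ∧
    (∀ t ∈ Ici (0:ℝ), HasDerivWithinAt X (X' t) (Ici 0) t) ∧
    (∀ t ∈ Ici (0:ℝ), ∀ x : ℝ,
      X' t x = ε⁻¹ * (X t (x - ε) * max (u (x - ε) t) 0
        - X t x * |u x t| + X t (x + ε) * max (-(u (x + ε) t)) 0))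

/-- Precomposition with the translation `x ↦ x + c`, as a continuous linear map on `C_b(ℝ)`. -/
noncomputable def translateCLM (c : ℝ) :
    BoundedContinuousFunction ℝ ℝ →L[ℝ] BoundedContinuousFunction ℝ ℝ :=
  LinearMap.mkContinuous
    { toFun := fun f => f.compContinuous ⟨fun x => x + c, by fun_prop⟩
      map_add' := fun _ _ => rfl
      map_smul' := fun _ _ => rfl } 1 fun f => by
    rw [one_mul]
    exact (BoundedContinuousFunction.norm_le (norm_nonneg f)).2 fun x => f.norm_coe_le_norm (x + c)

@[simp]
theorem translateCLM_apply (c : ℝ) (f : BoundedContinuousFunction ℝ ℝ) (x : ℝ) :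
    translateCLM c f x = f (x + c) :=
  rfl

namespace IsDiscreteTransportSol

variable {ε : ℝ} {u : ℝ → ℝ → ℝ} {X Y : ℝ → BoundedContinuousFunction ℝ ℝ}

theorem translate (hX : IsDiscreteTransportSol ε u X) {c : ℝ}
    (hu : ∀ x : ℝ, ∀ t ∈ Ici (0 : ℝ), u (x + c) t = u x t) :
    IsDiscreteTransportSol ε u fun t => translateCLM c (X t) := by
  obtain ⟨X', hX'_cont, hX', hX'_eq⟩ := hX
  refine ⟨fun t => translateCLM c (X' t), (translateCLM c).continuous.comp_continuousOn hX'_cont,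
    fun t ht => (translateCLM c).hasFDerivAt.comp_hasDerivWithinAt t (hX' t ht),
    fun t ht x => ?_⟩
  have hl : x + c - ε = x - ε + c := by ring
  have hr : x + c + ε = x + ε + c := by ring
  simp only [translateCLM_apply, hX'_eq t ht, hl, hr, hu _ t ht]

theorem sub (hX : IsDiscreteTransportSol ε u X) (hY : IsDiscreteTransportSol ε u Y) :
    IsDiscreteTransportSol ε u fun t => X t - Y t := by
  obtain ⟨X', hX'_cont, hX', hX'_eq⟩ := hX
  obtain ⟨Y', hY'_cont, hY', hY'_eq⟩ := hY
  refine ⟨fun t => X' t - Y' t, hX'_cont.sub hY'_cont,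
    fun t ht => (hX' t ht).sub (hY' t ht), fun t ht x => ?_⟩
  simp only [BoundedContinuousFunction.sub_apply, hX'_eq t ht, hY'_eq t ht]
  ring

theorem eq_zero_of_initial_eq_zero (hε : 0 < ε) (hX : IsDiscreteTransportSol ε u X)
    {M : ℝ} (hu : ∀ x : ℝ, ∀ t ∈ Ici (0 : ℝ), |u x t| ≤ M) (hX₀ : X 0 = 0)
    {t : ℝ} (ht : 0 ≤ t) : X t = 0 := by
  obtain ⟨X', -, hX', hX'_eq⟩ := hX
  have hM : 0 ≤ M := (abs_nonneg _).trans (hu 0 0 self_mem_Ici)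
  refine eq_zero_of_abs_deriv_le_mul_abs_self_of_eq_zero_right (f := X) (f' := X')
    (K := ε⁻¹ * (3 * M)) (a := 0) (b := t)
    (fun s hs => (hX' s hs.1).continuousWithinAt.mono Icc_subset_Ici_self)
    (fun s hs => (hX' s hs.1).mono (Ici_subset_Ici.2 hs.1)) hX₀ (fun s hs => ?_) t
    (right_mem_Icc.2 ht)
  have key : ∀ y a : ℝ, |a| ≤ M → |X s y * a| ≤ ‖X s‖ * M := fun y a ha => by
    rw [abs_mul]
    exact mul_le_mul ((X s).norm_coe_le_norm y) ha (abs_nonneg _) (norm_nonneg _)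
  have hpos : ∀ a : ℝ, |max a 0| ≤ |a| := fun a => by
    rw [abs_of_nonneg (le_max_right a 0)]
    exact max_le (le_abs_self a) (abs_nonneg a)
  refine (BoundedContinuousFunction.norm_le (by positivity)).2 fun x => ?_
  have h₁ := key (x - ε) (max (u (x - ε) s) 0) ((hpos _).trans (hu _ s hs.1))
  have h₂ := key x |u x s| ((abs_abs _).le.trans (hu _ s hs.1))
  have h₃ := key (x + ε) (max (-u (x + ε) s) 0)
    ((hpos _).trans ((abs_neg _).le.trans (hu _ s hs.1)))
  rw [hX'_eq s hs.1, Real.norm_eq_abs, abs_mul, abs_of_pos (inv_pos.2 hε), mul_assoc]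
  refine mul_le_mul_of_nonneg_left ?_ (inv_pos.2 hε).le
  rw [abs_le] at h₁ h₂ h₃ ⊢
  constructor <;> linarith

end IsDiscreteTransportSol

/-- If the velocity `u` and the initial value `v₀ = X(·,0)` are `2π`-periodic in `x`,
then any solution `X` of the discrete transport ODE is `2π`-periodic in `x` at every
time `t ≥ 0`. -/
theorem stmt1 (ε : ℝ) (hε : 0 < ε) (u : ℝ → ℝ → ℝ)
    (hu_cont : ContinuousOn (fun p : ℝ × ℝ => u p.1 p.2) (univ ×ˢ Ici 0))
    (hu_bdd : ∃ M : ℝ, ∀ x : ℝ, ∀ t ∈ Ici (0:ℝ), |u x t| ≤ M)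
    (hu_curve : ∃ U : ℝ → BoundedContinuousFunction ℝ ℝ,
      ContinuousOn U (Ici 0) ∧ ∀ t ∈ Ici (0:ℝ), ∀ x : ℝ, U t x = u x t)
    (X : ℝ → BoundedContinuousFunction ℝ ℝ)
    (hX : IsDiscreteTransportSol ε u X)
    (hu_per : ∀ x : ℝ, ∀ t ∈ Ici (0:ℝ), u (x + 2*π) t = u x t)
    (hv₀_per : ∀ x : ℝ, X 0 (x + 2*π) = X 0 x) :
    ∀ t ∈ Ici (0:ℝ), ∀ x : ℝ, X t (x + 2*π) = X t x := by
  obtain ⟨M, hM⟩ := hu_bdd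
  intro t ht x
  have h := ((hX.translate hu_per).sub hX).eq_zero_of_initial_eq_zero hε hM
    (BoundedContinuousFunction.ext fun y => sub_eq_zero.2 (hv₀_per y)) ht
  exact sub_eq_zero.1 (DFunLike.congr_fun h x)
end

section
/- (Lemma 1.) Let ε ∈ (0,1), let u : ℝ × [0,∞) → ℝ be continuous, bounded and 2π-periodic in x, with t ↦ u(·,t) a continuous curve in C_b(ℝ), let v₀ ∈ C_b(ℝ) be 2π-periodic, and let X be a solution of the discrete transport ODE with velocity u and step ε with X(·,0) = v₀ and X(·,t) 2π-periodic for all t. Then for every t ≥ 0, ∫_{−π}^{π} |X(x,t)| dx ≤ ∫_{−π}^{π} |v₀(x)| dx. -/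
open MeasureTheory Set Real

/-- The integral of a `T`-periodic function over an interval of length `T` is invariant under
translation of the function. -/
theorem intervalIntegral_comp_add_right_of_periodic {g : ℝ → ℝ} (hg : Function.Periodic g (2 * π))
    (d : ℝ) : (∫ x in (-π)..π, g (x + d)) = ∫ x in (-π)..π, g x := by
  rw [intervalIntegral.integral_comp_add_right]
  have h := hg.intervalIntegral_add_eq (-π + d) (-π)
  rwa [show -π + d + 2 * π = π + d by ring, show -π + 2 * π = π by ring] at h

/-- An explicit Euler step of the upwind scheme satisfying the CFL condition does not increase
the `L¹`-norm on a period. -/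
theorem integral_abs_upwind_step_le {w v : ℝ → ℝ} (hw : Continuous w) (hv : Continuous v)
    (hwp : Function.Periodic w (2 * π)) (hvp : Function.Periodic v (2 * π)) (ε : ℝ) {c : ℝ}
    (hc : 0 ≤ c) (hcfl : ∀ x, c * |v x| ≤ 1) :
    (∫ x in (-π)..π, |w x + c * (w (x - ε) * max (v (x - ε)) 0 - w x * |v x|
      + w (x + ε) * max (-(v (x + ε))) 0)|) ≤ ∫ x in (-π)..π, |w x| := by
  let p : ℝ → ℝ := fun x => c * (|w x| * max (v x) 0)
  let q : ℝ → ℝ := fun x => c * (|w x| * max (-(v x)) 0)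
  have hp : Continuous p := by fun_prop
  have hq : Continuous q := by fun_prop
  have hpp : Function.Periodic p (2 * π) := fun x => by simp only [p, hwp x, hvp x]
  have hqp : Function.Periodic q (2 * π) := fun x => by simp only [q, hwp x, hvp x]
  have hpc : Continuous fun x => p (x + -ε) := by fun_prop
  have hqc : Continuous fun x => q (x + ε) := by fun_prop
  have hr : Continuous fun x => |w x| * (1 - c * |v x|) := by fun_prop
  have hrpc : Continuous fun x => |w x| * (1 - c * |v x|) + p (x + -ε) := hr.add hpc
  have hrp : Continuous fun x => |w x| * (1 - c * |v x|) + p x := hr.add hp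
  calc
    _ ≤ ∫ x in (-π)..π, (|w x| * (1 - c * |v x|) + p (x + -ε) + q (x + ε)) := by
      refine intervalIntegral.integral_mono_on (by linarith [pi_pos])
        (Continuous.intervalIntegrable (by fun_prop) _ _)
        ((hrpc.add hqc).intervalIntegrable _ _) fun x _ => ?_
      have hpos : 0 ≤ 1 - c * |v x| := by linarith [hcfl x]
      have hsplit : w x + c * (w (x - ε) * max (v (x - ε)) 0 - w x * |v x|
          + w (x + ε) * max (-(v (x + ε))) 0) = w x * (1 - c * |v x|)
          + c * (w (x - ε) * max (v (x - ε)) 0)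
          + c * (w (x + ε) * max (-(v (x + ε))) 0) := by ring
      rw [hsplit]
      refine (abs_add_three _ _ _).trans (le_of_eq ?_)
      simp only [p, q, abs_mul, abs_of_nonneg hpos, abs_of_nonneg hc, ← sub_eq_add_neg,
        abs_of_nonneg (le_max_right _ (0 : ℝ))]
    _ = (∫ x in (-π)..π, |w x| * (1 - c * |v x|)) + (∫ x in (-π)..π, p x)
        + ∫ x in (-π)..π, q x := by
      rw [intervalIntegral.integral_add (hrpc.intervalIntegrable _ _)
          (hqc.intervalIntegrable _ _),
        intervalIntegral.integral_add (hr.intervalIntegrable _ _) (hpc.intervalIntegrable _ _),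
        intervalIntegral_comp_add_right_of_periodic hpp,
        intervalIntegral_comp_add_right_of_periodic hqp]
    _ = ∫ x in (-π)..π, |w x| := by
      rw [← intervalIntegral.integral_add (hr.intervalIntegrable _ _) (hp.intervalIntegrable _ _),
        ← intervalIntegral.integral_add (hrp.intervalIntegrable _ _)
          (hq.intervalIntegrable _ _)]
      refine intervalIntegral.integral_congr fun x _ => ?_
      simp only [p, q]
      rcases le_total 0 (v x) with h | h
      · rw [abs_of_nonneg h, max_eq_left h, max_eq_right (by linarith)]; ring
      · rw [abs_of_nonpos h, max_eq_right h, max_eq_left (by linarith)]; ring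

/-- The `L¹`-norm on a period is Lipschitz with respect to the sup norm. -/
theorem integral_abs_le_add_norm_sub (f g : BoundedContinuousFunction ℝ ℝ) :
    (∫ x in (-π)..π, |f x|) ≤ (∫ x in (-π)..π, |g x|) + 2 * π * ‖f - g‖ := by
  have hconst : (∫ _ in (-π)..π, ‖f - g‖) = 2 * π * ‖f - g‖ := by
    rw [intervalIntegral.integral_const, smul_eq_mul]; ring
  have hf : Continuous fun x => |f x| := f.continuous.abs
  have hg : Continuous fun x => |g x| := g.continuous.abs
  rw [← hconst, ← intervalIntegral.integral_add (hg.intervalIntegrable _ _)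
    (continuous_const.intervalIntegrable _ _)]
  refine intervalIntegral.integral_mono_on (by linarith [pi_pos]) (hf.intervalIntegrable _ _)
    ((hg.add continuous_const).intervalIntegrable _ _) fun x _ => ?_
  have h1 : |f x - g x| ≤ ‖f - g‖ := (f - g).norm_coe_le_norm x
  linarith [abs_sub_abs_le_abs_sub (f x) (g x)]

/-- The `L¹`-norm on a period is continuous with respect to the sup norm. -/
theorem continuous_integral_abs :
    Continuous fun f : BoundedContinuousFunction ℝ ℝ => ∫ x in (-π)..π, |f x| := by
  refine (LipschitzWith.of_le_add_mul (2 * π).toNNReal fun f g => ?_).continuous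
  rw [Real.coe_toNNReal _ (by positivity), dist_eq_norm]
  exact integral_abs_le_add_norm_sub f g

/-- Lemma 1: for a `2π`-periodic solution of the discrete transport ODE with
`2π`-periodic bounded continuous velocity and step `ε ∈ (0,1)`, the `L¹`-norm on a
period is nonincreasing: `∫_{−π}^{π} |X(x,t)| dx ≤ ∫_{−π}^{π} |v₀(x)| dx` for all `t ≥ 0`. -/
theorem stmt2 (ε : ℝ) (hε : ε ∈ Ioo (0:ℝ) 1) (u : ℝ → ℝ → ℝ)
    (hu_cont : ContinuousOn (fun p : ℝ × ℝ => u p.1 p.2) (univ ×ˢ Ici 0))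
    (hu_bdd : ∃ M : ℝ, ∀ x : ℝ, ∀ t ∈ Ici (0:ℝ), |u x t| ≤ M)
    (hu_curve : ∃ U : ℝ → BoundedContinuousFunction ℝ ℝ,
      ContinuousOn U (Ici 0) ∧ ∀ t ∈ Ici (0:ℝ), ∀ x : ℝ, U t x = u x t)
    (hu_per : ∀ x : ℝ, ∀ t ∈ Ici (0:ℝ), u (x + 2*π) t = u x t)
    (v₀ : BoundedContinuousFunction ℝ ℝ)
    (hv₀_per : ∀ x : ℝ, v₀ (x + 2*π) = v₀ x)
    (X : ℝ → BoundedContinuousFunction ℝ ℝ)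
    (hX : IsDiscreteTransportSol ε u X)
    (hX0 : X 0 = v₀)
    (hX_per : ∀ t ∈ Ici (0:ℝ), ∀ x : ℝ, X t (x + 2*π) = X t x) :
    ∀ t ∈ Ici (0:ℝ),
      (∫ x in (-π)..π, |X t x|) ≤ ∫ x in (-π)..π, |v₀ x| := by
  obtain ⟨X', -, hX', hode⟩ := hX
  obtain ⟨M, hM⟩ := hu_bdd
  obtain ⟨U, -, hU⟩ := hu_curve
  intro T hT
  have hε0 : 0 < ε := hε.1
  have hslope : ∀ t ∈ Ico (0 : ℝ) T, ∀ r : ℝ, 0 < r →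
      ∃ᶠ z in nhdsWithin t (Ioi t), slope (fun s => ∫ x in (-π)..π, |X s x|) t z < r := by
    intro t ht r hr
    have ht0 : t ∈ Ici (0 : ℝ) := ht.1
    have hu_t : Continuous fun x => u x t := by
      have h := (U t).continuous
      rwa [show ⇑(U t) = fun x => u x t from funext (hU t ht0)] at h
    have hderiv : HasDerivWithinAt X (X' t) (Ioi t) t :=
      (hX' t ht0).mono fun z hz => ht.1.trans (le_of_lt hz)
    have hpi : (0 : ℝ) < r / (4 * π) := by positivity
    have hlittle := hderiv.isLittleO.def hpi
    have hM1 : 0 < |M| + 1 := by positivity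
    have hnear : ∀ᶠ z in nhdsWithin t (Ioi t), z < t + ε / (|M| + 1) :=
      nhdsWithin_le_nhds (Iio_mem_nhds (by linarith [div_pos hε0 hM1]))
    refine Filter.Eventually.frequently ?_
    filter_upwards [hlittle, hnear, self_mem_nhdsWithin] with z hz hzlt hzt
    have hh : 0 < z - t := sub_pos.2 hzt
    rw [Real.norm_of_nonneg hh.le] at hz
    have hcfl : ∀ x, (z - t) * ε⁻¹ * |u x t| ≤ 1 := by
      intro x
      have h1 : (z - t) * (|M| + 1) ≤ ε := by
        rw [← le_div_iff₀ hM1]; linarith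
      have h2 : |u x t| ≤ |M| + 1 := by linarith [hM x t ht0, le_abs_self M]
      calc (z - t) * ε⁻¹ * |u x t| = (z - t) * |u x t| / ε := by ring
        _ ≤ 1 := by
          rw [div_le_one hε0]
          exact (mul_le_mul_of_nonneg_left h2 hh.le).trans h1
    have hstep := integral_abs_upwind_step_le (X t).continuous hu_t (hX_per t ht0)
      (fun x => hu_per x t ht0) ε (by positivity) hcfl
    have hEuler : (∫ x in (-π)..π, |(X t + (z - t) • X' t) x|) ≤ ∫ x in (-π)..π, |X t x| := by
      refine le_of_eq_of_le (intervalIntegral.integral_congr fun x _ => ?_) hstep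
      simp only [BoundedContinuousFunction.coe_add, BoundedContinuousFunction.coe_smul,
        Pi.add_apply, smul_eq_mul, hode t ht0 x, mul_assoc]
    have hdiff := integral_abs_le_add_norm_sub (X z) (X t + (z - t) • X' t)
    rw [← sub_sub] at hdiff
    have herr : 2 * π * ‖X z - X t - (z - t) • X' t‖ ≤ r / 2 * (z - t) := by
      calc _ ≤ 2 * π * (r / (4 * π) * (z - t)) := by gcongr
        _ = r / 2 * (z - t) := by field_simp; ring
    rw [slope_def_field, div_lt_iff₀ hh]
    nlinarith [mul_pos hr hh]
  have hcont : ContinuousOn (fun s => ∫ x in (-π)..π, |X s x|) (Icc 0 T) :=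
    continuous_integral_abs.comp_continuousOn fun s hs =>
      ((hX' s hs.1).continuousWithinAt).mono Icc_subset_Ici_self
  rw [← hX0]
  exact image_le_of_liminf_slope_right_le_deriv_boundary
    (B := fun _ => ∫ x in (-π)..π, |X 0 x|) (B' := fun _ => 0) hcont le_rfl
    continuousOn_const (fun _ _ => hasDerivWithinAt_const _ _ _) hslope ⟨hT, le_rfl⟩
end

section
/- (Lemma 2.) Assume: (i) (u_ε)_{ε∈(0,1)} is a family of continuous functions ℝ × [0,∞) → ℝ, each C¹ in x and 2π-periodic in x, with t ↦ u_ε(·,t) a continuous curve in C_b(ℝ), such that there is M₁ > 0 with |u_ε(x,t)| ≤ M₁ for all ε, x, t, and there is β > 0 such that for every δ > 0 there is C_δ with |∂ₓu_ε(x,t)| ≤ C_δ/ε^β for all ε ∈ (0,1), x ∈ ℝ, t ∈ [0,δ]; (ii) (v₀ε)_{ε∈(0,1)} are continuous 2π-periodic functions with ∫_{−π}^{π}|v₀ε(x)|dx ≤ C₀ for all ε; (iii) for each ε, X_ε is the solution of the discrete transport ODE with velocity u_ε and step ε with X_ε(·,0) = v₀ε and X_ε(·,t) 2π-periodic; (iv)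 α ∈ (0,1] with 0 < β < α, and v_ε(x,t) = (X_ε(·,t) * φ_{ε^α})(x). Then for every ψ ∈ C_c^∞(ℝ) and every δ > 0, sup_{t∈[0,δ]} |∫_ℝ (∂ₜv_ε(x,t)ψ(x) − u_ε(x,t)v_ε(x,t)ψ'(x)) dx| → 0 as ε → 0. -/
open MeasureTheory Set Real

/-- The `L¹` norm of a bounded continuous function over the period `[-π, π]`. -/
noncomputable def periodL1 (f : BoundedContinuousFunction ℝ ℝ) : ℝ := ∫ x in (-π)..π, |f x|

lemma periodL1_le_add_norm_sub (f g : BoundedContinuousFunction ℝ ℝ) :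
    periodL1 f ≤ periodL1 g + 2 * π * ‖f - g‖ := by
  have hpi : -π ≤ π := by linarith [pi_pos]
  have hconst : ∫ _ in (-π)..π, ‖f - g‖ = 2 * π * ‖f - g‖ := by
    rw [intervalIntegral.integral_const, smul_eq_mul]; ring
  rw [periodL1, periodL1, ← hconst, ← intervalIntegral.integral_add
    ((map_continuous g).abs.intervalIntegrable _ _) intervalIntegrable_const]
  refine intervalIntegral.integral_mono_on hpi ((map_continuous f).abs.intervalIntegrable _ _)
    (((map_continuous g).abs.add continuous_const).intervalIntegrable _ _) fun x _ => ?_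
  have h := (f - g).norm_coe_le_norm x
  rw [Real.norm_eq_abs, BoundedContinuousFunction.sub_apply] at h
  linarith [abs_sub_abs_le_abs_sub (f x) (g x)]

lemma continuous_periodL1 : Continuous periodL1 := by
  refine (LipschitzWith.of_le_add_mul (2 * π).toNNReal fun f g => ?_).continuous
  rw [Real.coe_toNNReal _ (by positivity), dist_eq_norm]
  exact periodL1_le_add_norm_sub f g

lemma Function.Periodic.intervalIntegral_comp_add {g : ℝ → ℝ} (hg : Function.Periodic g (2 * π))
    (a : ℝ) : ∫ x in (-π)..π, g (x + a) = ∫ x in (-π)..π, g x := by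
  rw [intervalIntegral.integral_comp_add_right]
  have h := hg.intervalIntegral_add_eq (-π + a) (-π)
  convert h using 2 <;> ring

/-- An explicit Euler step of the discrete transport equation does not increase the `L¹` norm
under the CFL condition `τ M ≤ ε`. -/
lemma periodL1_add_smul_le {ε M τ : ℝ} {w : ℝ → ℝ} {Y Y' : BoundedContinuousFunction ℝ ℝ}
    (hε : 0 < ε) (hw : Continuous w) (hwM : ∀ x, |w x| ≤ M)
    (hwper : Function.Periodic w (2 * π)) (hYper : Function.Periodic Y (2 * π))
    (hY' : ∀ x, Y' x = ε⁻¹ * (Y (x - ε) * max (w (x - ε)) 0 - Y x * |w x|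
      + Y (x + ε) * max (-(w (x + ε))) 0))
    (hτ : 0 ≤ τ) (hτM : τ * M ≤ ε) :
    periodL1 (Y + τ • Y') ≤ periodL1 Y := by
  have hpi : -π ≤ π := by linarith [pi_pos]
  set p : ℝ → ℝ := fun x => |Y x| * max (w x) 0 with hp
  set q : ℝ → ℝ := fun x => |Y x| * max (-(w x)) 0 with hq
  have hpc : Continuous p := (map_continuous Y).abs.mul (hw.max continuous_const)
  have hqc : Continuous q := (map_continuous Y).abs.mul (hw.neg.max continuous_const)
  have hpp : Function.Periodic p (2 * π) := fun x => by simp only [hp, hYper x, hwper x]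
  have hqp : Function.Periodic q (2 * π) := fun x => by simp only [hq, hYper x, hwper x]
  have hpq : ∀ x, p x + q x = |Y x| * |w x| := fun x => by
    rw [hp, hq, ← mul_add]
    congr 1
    rcases le_total 0 (w x) with h | h
    · rw [max_eq_left h, max_eq_right (by linarith), abs_of_nonneg h, add_zero]
    · rw [max_eq_right h, max_eq_left (by linarith), abs_of_nonpos h, zero_add]
  have hpi1 : IntervalIntegrable (fun x => p (x + -ε)) volume (-π) π :=
    (hpc.comp (continuous_id.add continuous_const)).intervalIntegrable _ _
  have hqi1 : IntervalIntegrable (fun x => q (x + ε)) volume (-π) π :=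
    (hqc.comp (continuous_id.add continuous_const)).intervalIntegrable _ _
  have hpi0 := hpc.intervalIntegrable (μ := volume) (-π) π
  have hqi0 := hqc.intervalIntegrable (μ := volume) (-π) π
  have hYi := (map_continuous Y).abs.intervalIntegrable (μ := volume) (-π) π
  have hsum : ∫ x in (-π)..π, (|Y x| + τ * ε⁻¹ * ((p (x + -ε) - p x) + (q (x + ε) - q x)))
      = periodL1 Y := by
    rw [intervalIntegral.integral_add hYi
        (((hpi1.sub hpi0).add (hqi1.sub hqi0)).const_mul _),
      intervalIntegral.integral_const_mul,
      intervalIntegral.integral_add (hpi1.sub hpi0) (hqi1.sub hqi0),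
      intervalIntegral.integral_sub hpi1 hpi0, intervalIntegral.integral_sub hqi1 hqi0,
      hpp.intervalIntegral_comp_add, hqp.intervalIntegral_comp_add, periodL1]
    ring
  rw [← hsum, periodL1]
  refine intervalIntegral.integral_mono_on hpi
    ((map_continuous (Y + τ • Y')).abs.intervalIntegrable _ _)
    (hYi.add (((hpi1.sub hpi0).add (hqi1.sub hqi0)).const_mul _)) fun x _ => ?_
  have hc : 0 ≤ τ * ε⁻¹ := by positivity
  have hcw : 0 ≤ 1 - τ * ε⁻¹ * |w x| := by
    have h1 : τ * |w x| ≤ ε := (mul_le_mul_of_nonneg_left (hwM x) hτ).trans hτM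
    have h2 : τ * ε⁻¹ * |w x| = (τ * |w x|) / ε := by field_simp
    rw [h2, sub_nonneg]
    exact (div_le_one hε).2 h1
  have hdecomp : (Y + τ • Y') x = Y x * (1 - τ * ε⁻¹ * |w x|)
      + τ * ε⁻¹ * (Y (x - ε) * max (w (x - ε)) 0)
      + τ * ε⁻¹ * (Y (x + ε) * max (-(w (x + ε))) 0) := by
    simp only [BoundedContinuousFunction.add_apply, BoundedContinuousFunction.smul_apply,
      smul_eq_mul, hY']
    ring
  have habs := abs_add_three (Y x * (1 - τ * ε⁻¹ * |w x|))
    (τ * ε⁻¹ * (Y (x - ε) * max (w (x - ε)) 0)) (τ * ε⁻¹ * (Y (x + ε) * max (-(w (x + ε))) 0))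
  rw [← hdecomp, abs_mul, abs_of_nonneg hcw, abs_mul (τ * ε⁻¹), abs_mul (τ * ε⁻¹),
    abs_of_nonneg hc, abs_mul (Y (x - ε)), abs_mul (Y (x + ε)),
    abs_of_nonneg (le_max_right (w (x - ε)) 0),
    abs_of_nonneg (le_max_right (-(w (x + ε))) 0)] at habs
  have hx := hpq x
  calc |(Y + τ • Y') x| ≤ _ := habs
    _ = |Y x| + τ * ε⁻¹ * (p (x + -ε) + q (x + ε) - |Y x| * |w x|) := by
      simp only [hp, hq, ← sub_eq_add_neg]; ring
    _ = _ := by rw [← hx]; ring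

/-- The discrete transport equation is an `L¹` contraction on periodic solutions. -/
lemma IsDiscreteTransportSol.periodL1_le {ε M : ℝ} {u : ℝ → ℝ → ℝ}
    {X : ℝ → BoundedContinuousFunction ℝ ℝ} (hX : IsDiscreteTransportSol ε u X)
    (hε : 0 < ε) (hM : 0 < M) (hu : ∀ t ∈ Ici (0:ℝ), Continuous fun x => u x t)
    (huM : ∀ x, ∀ t ∈ Ici (0:ℝ), |u x t| ≤ M)
    (huper : ∀ t ∈ Ici (0:ℝ), Function.Periodic (fun x => u x t) (2 * π))
    (hXper : ∀ t ∈ Ici (0:ℝ), Function.Periodic (X t) (2 * π))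
    {t : ℝ} (ht : 0 ≤ t) : periodL1 (X t) ≤ periodL1 (X 0) := by
  obtain ⟨X', -, hderiv, heq⟩ := hX
  have hcont : ContinuousOn X (Ici 0) := fun s hs => (hderiv s hs).continuousWithinAt
  refine image_le_of_liminf_slope_right_le_deriv_boundary (f := fun s => periodL1 (X s))
    (a := 0) (b := t) (B := fun _ => periodL1 (X 0)) (B' := fun _ => 0)
    (continuous_periodL1.comp_continuousOn (hcont.mono Icc_subset_Ici_self)) le_rfl
    continuousOn_const (fun s _ => hasDerivWithinAt_const _ _ _) ?_ ⟨ht, le_rfl⟩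
  intro s hs r hr
  have hs0 : s ∈ Ici (0:ℝ) := hs.1
  have hd := ((hderiv s hs0).mono (fun z (hz : z ∈ Ioi s) => hs.1.trans (le_of_lt hz)))
  rw [hasDerivWithinAt_iff_isLittleO] at hd
  have hlo := hd.def (show (0:ℝ) < r / (4 * π) by positivity)
  have hclose : ∀ᶠ z in nhdsWithin s (Ioi s), z ∈ Ioo s (s + ε / M) :=
    Ioo_mem_nhdsGT (by have : 0 < ε / M := by positivity
                       linarith)
  refine Filter.Eventually.frequently ?_
  filter_upwards [hlo, hclose] with z hz hzs
  have hpos : 0 < z - s := sub_pos.2 hzs.1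
  have hstep := periodL1_add_smul_le (τ := z - s) hε (hu s hs0) (fun x => huM x s hs0)
    (huper s hs0) (hXper s hs0) (heq s hs0) hpos.le
    (by have : z - s ≤ ε / M := by linarith [hzs.2]
        exact (le_div_iff₀ hM).1 this)
  have hlip := periodL1_le_add_norm_sub (X z) (X s + (z - s) • X' s)
  rw [← sub_sub] at hlip
  rw [Real.norm_eq_abs, abs_of_pos hpos] at hz
  have hz' : 2 * π * ‖X z - X s - (z - s) • X' s‖ ≤ r / 2 * (z - s) := by
    calc _ ≤ 2 * π * (r / (4 * π) * (z - s)) := by gcongr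
      _ = _ := by field_simp; ring
  rw [slope_def_field, div_lt_iff₀ hpos]
  have : 0 < r / 2 * (z - s) := by positivity
  linarith

/-- Over `n` periods on each side of the origin, the `L¹` norm is `2n` times that of a period. -/
lemma integral_abs_eq_mul_periodL1 {Y : BoundedContinuousFunction ℝ ℝ}
    (hY : Function.Periodic Y (2 * π)) (n : ℕ) :
    ∫ x in (-(n * (2 * π)))..(n * (2 * π)), |Y x| = 2 * n * periodL1 Y := by
  have hper : Function.Periodic (fun x => |Y x|) (2 * π) := fun x => by simp only [hY x]
  have h := hper.intervalIntegral_add_zsmul_eq (2 * n) (-(n * (2 * π)))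
    (fun a b => (map_continuous Y).abs.intervalIntegrable a b)
  rw [hper.intervalIntegral_add_eq _ (-π)] at h
  simp only [zsmul_eq_mul] at h
  push_cast at h
  rw [periodL1]
  convert h using 3 <;> ring

lemma abs_taylor_one_le {ψ : ℝ → ℝ} (hψ : ContDiff ℝ 2 ψ) {C : ℝ}
    (hC : ∀ x, |deriv (deriv ψ) x| ≤ C) (a h : ℝ) :
    |ψ (a + h) - ψ a - h * deriv ψ a| ≤ C * h ^ 2 := by
  have hd : Differentiable ℝ ψ := hψ.differentiable (by norm_num)
  have hd' : Differentiable ℝ (deriv ψ) :=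
    (ContDiff.iterate_deriv' 1 1 hψ).differentiable (by norm_num)
  have hlip : ∀ x, |deriv ψ x - deriv ψ a| ≤ C * |x - a| := fun x =>
    convex_univ.norm_image_sub_le_of_norm_deriv_le (fun z _ => hd' z) (fun z _ => hC z)
      (mem_univ a) (mem_univ x)
  have hC0 : 0 ≤ C := (abs_nonneg _).trans (hC 0)
  have key := (convex_uIcc a (a + h)).norm_image_sub_le_of_norm_hasDerivWithin_le
    (f := fun x => ψ x - x * deriv ψ a) (f' := fun x => deriv ψ x - deriv ψ a) (C := C * |h|)
    (fun x _ => ((hd x).hasDerivAt.sub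
      (by simpa using (hasDerivAt_id x).mul_const (deriv ψ a))).hasDerivWithinAt)
    (fun x hx => (hlip x).trans (by
      have := abs_sub_left_of_mem_uIcc hx
      rw [add_sub_cancel_left] at this
      gcongr))
    left_mem_uIcc right_mem_uIcc
  rw [Real.norm_eq_abs, Real.norm_eq_abs, add_sub_cancel_left, mul_assoc, ← sq, sq_abs] at key
  convert key using 2
  ring

/-- Discrete integration by parts: the upwind operator is moved onto the test function. -/
lemma integral_upwind_mul {p q ψ : ℝ → ℝ} (hp : Continuous p) (hq : Continuous q)
    (hψ : Continuous ψ) (hψc : HasCompactSupport ψ) (c ε y : ℝ) :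
    ∫ x, c * (p (x - y - ε) - (p (x - y) + q (x - y)) + q (x - y + ε)) * ψ x
      = ∫ z, c * (p z * (ψ (z + y + ε) - ψ (z + y)) + q z * (ψ (z + y - ε) - ψ (z + y))) := by
  have hint : ∀ {f : ℝ → ℝ}, Continuous f → ∀ a : ℝ, Integrable fun x => f (x - a) * ψ x :=
    fun hf a => ((hf.comp (continuous_id.sub continuous_const)).mul
      hψ).integrable_of_hasCompactSupport hψc.mul_left
  have hshift : ∀ (f : ℝ → ℝ) (a : ℝ), ∫ x, f (x - a) * ψ x = ∫ z, f z * ψ (z + a) := by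
    intro f a
    simpa using integral_sub_right_eq_self (μ := volume) (fun z => f z * ψ (z + a)) a
  have hint' : ∀ {f : ℝ → ℝ}, Continuous f → ∀ a : ℝ, Integrable fun z => f z * ψ (z + a) := by
    intro f hf a
    simpa using (hint hf a).comp_add_right a
  have hl : ∀ x, c * (p (x - y - ε) - (p (x - y) + q (x - y)) + q (x - y + ε)) * ψ x
      = c * (p (x - (y + ε)) * ψ x - p (x - y) * ψ x
        + (q (x - (y - ε)) * ψ x - q (x - y) * ψ x)) := fun x => by
    rw [← sub_sub x y ε, ← sub_add x y ε]; ring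
  have hr : ∀ z, c * (p z * (ψ (z + y + ε) - ψ (z + y)) + q z * (ψ (z + y - ε) - ψ (z + y)))
      = c * (p z * ψ (z + (y + ε)) - p z * ψ (z + y)
        + (q z * ψ (z + (y - ε)) - q z * ψ (z + y))) := fun z => by
    rw [← add_assoc z y ε, ← add_sub_assoc z y ε]; ring
  simp_rw [hl, hr]
  have hcomb : ∀ {f g f' g' : ℝ → ℝ}, Integrable f → Integrable g → Integrable f' →
      Integrable g' → ∫ x, (f x - g x + (f' x - g' x))
        = (∫ x, f x) - (∫ x, g x) + ((∫ x, f' x) - ∫ x, g' x) := fun hf hg hf' hg' => by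
    rw [← integral_sub hf hg, ← integral_sub hf' hg']
    exact integral_add (hf.sub hg) (hf'.sub hg')
  rw [integral_const_mul, integral_const_mul,
    hcomb (hint hp _) (hint hp _) (hint hq _) (hint hq _),
    hcomb (hint' hp _) (hint' hp _) (hint' hq _) (hint' hq _)]
  simp_rw [hshift]

/-- Consistency error of the upwind operator, tested against a translate of `ψ`. -/
lemma abs_integral_upwind_sub_le {ε M L C₁ C₂ R K y : ℝ} {w ψ : ℝ → ℝ}
    {Y Y' : BoundedContinuousFunction ℝ ℝ}
    (hε : 0 < ε) (hw : Continuous w) (hwM : ∀ x, |w x| ≤ M)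
    (hwL : ∀ a b, |w a - w b| ≤ L * |a - b|)
    (hY' : ∀ x, Y' x = ε⁻¹ * (Y (x - ε) * max (w (x - ε)) 0 - Y x * |w x|
      + Y (x + ε) * max (-(w (x + ε))) 0))
    (hψ : ContDiff ℝ 2 ψ) (hψR : tsupport ψ ⊆ Metric.closedBall 0 R)
    (hC₁ : ∀ x, |deriv ψ x| ≤ C₁) (hC₂ : ∀ x, |deriv (deriv ψ) x| ≤ C₂)
    (hK : 0 ≤ K) (hRK : R + |y| + ε ≤ K) :
    |∫ x, (Y' (x - y) * ψ x - w x * Y (x - y) * deriv ψ x)|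
      ≤ (M * C₂ * ε + L * |y| * C₁) * ∫ x in (-K)..K, |Y x| := by
  have hψc : HasCompactSupport ψ :=
    (isCompact_closedBall (0:ℝ) R).of_isClosed_subset (isClosed_tsupport ψ) hψR
  have hψ0 : ∀ x, R < |x| → ψ x = 0 := fun x hx => by
    refine image_eq_zero_of_notMem_tsupport fun h => ?_
    have := hψR h
    rw [mem_closedBall_zero_iff, Real.norm_eq_abs] at this
    linarith
  have hdψ0 : ∀ x, R < |x| → deriv ψ x = 0 := fun x hx => by
    refine image_eq_zero_of_notMem_tsupport fun h => ?_
    have := hψR (tsupport_deriv_subset (𝕜 := ℝ) h)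
    rw [mem_closedBall_zero_iff, Real.norm_eq_abs] at this
    linarith
  have hdψ : Continuous (deriv ψ) := hψ.continuous_deriv (by norm_num)
  have hM : 0 ≤ M := (abs_nonneg _).trans (hwM 0)
  have hC₁0 : 0 ≤ C₁ := (abs_nonneg _).trans (hC₁ 0)
  have hC₂0 : 0 ≤ C₂ := (abs_nonneg _).trans (hC₂ 0)
  have hL : 0 ≤ L := by simpa using (abs_nonneg _).trans (hwL 1 0)
  have hYc := map_continuous Y
  set p : ℝ → ℝ := fun x => Y x * max (w x) 0 with hp
  set q : ℝ → ℝ := fun x => Y x * max (-(w x)) 0 with hq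
  have hpc : Continuous p := hYc.mul (hw.max continuous_const)
  have hqc : Continuous q := hYc.mul (hw.neg.max continuous_const)
  have hsub : Continuous fun x : ℝ => x - y := continuous_id.sub continuous_const
  have hposneg : ∀ r : ℝ, max r 0 + max (-r) 0 = |r| ∧ max r 0 - max (-r) 0 = r := fun r => by
    rcases le_total 0 r with h | h
    · rw [max_eq_left h, max_eq_right (by linarith), abs_of_nonneg h]; constructor <;> ring
    · rw [max_eq_right h, max_eq_left (by linarith), abs_of_nonpos h]; constructor <;> ring
  have hY'p : ∀ x, Y' (x - y)
      = ε⁻¹ * (p (x - y - ε) - (p (x - y) + q (x - y)) + q (x - y + ε)) := fun x => by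
    rw [hY']
    simp only [hp, hq, ← (hposneg (w (x - y))).1]
    ring
  have hi1 : Integrable fun x => Y' (x - y) * ψ x :=
    (((map_continuous Y').comp hsub).mul hψ.continuous).integrable_of_hasCompactSupport
      hψc.mul_left
  have hi2 : Integrable fun x => w x * Y (x - y) * deriv ψ x :=
    ((hw.mul (hYc.comp hsub)).mul hdψ).integrable_of_hasCompactSupport hψc.deriv.mul_left
  have hshift : ∫ x, w x * Y (x - y) * deriv ψ x
      = ∫ z, w (z + y) * Y z * deriv ψ (z + y) := by
    simpa using integral_sub_right_eq_self (μ := volume)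
      (fun z => w (z + y) * Y z * deriv ψ (z + y)) y
  have hi2' : Integrable fun z => w (z + y) * Y z * deriv ψ (z + y) := by
    simpa using hi2.comp_add_right y
  set S : ℝ → ℝ := fun z =>
    ε⁻¹ * (p z * (ψ (z + y + ε) - ψ (z + y)) + q z * (ψ (z + y - ε) - ψ (z + y))) with hS
  have hzero : ∀ z, K < |z| → ψ (z + y + ε) = 0 ∧ ψ (z + y) = 0 ∧ ψ (z + y - ε) = 0
      ∧ deriv ψ (z + y) = 0 := fun z hz => by
    have h0 : |z| - |y| ≤ |z + y| := by simpa using abs_sub_abs_le_abs_sub z (-y)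
    have h1 : |z + y| - |ε| ≤ |z + y + ε| := by simpa using abs_sub_abs_le_abs_sub (z + y) (-ε)
    have h2 := abs_sub_abs_le_abs_sub (z + y) ε
    rw [abs_of_pos hε] at h1 h2
    exact ⟨hψ0 _ (by linarith), hψ0 _ (by linarith), hψ0 _ (by linarith), hdψ0 _ (by linarith)⟩
  have hScont : Continuous S := by
    have := hψ.continuous
    fun_prop
  have hSi : Integrable S := by
    refine hScont.integrable_of_hasCompactSupport
      (HasCompactSupport.intro (isCompact_closedBall (0:ℝ) K) fun z hz => ?_)
    rw [mem_closedBall_zero_iff, Real.norm_eq_abs, not_le] at hz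
    obtain ⟨h1, h2, h3, -⟩ := hzero z hz
    simp [hS, h1, h2, h3]
  rw [integral_sub hi1 hi2]
  simp_rw [hY'p]
  rw [integral_upwind_mul hpc hqc hψ.continuous hψc, hshift, ← integral_sub hSi hi2',
    intervalIntegral.integral_of_le (by linarith), ← integral_Icc_eq_integral_Ioc,
    ← integral_const_mul, ← integral_indicator measurableSet_Icc, ← Real.norm_eq_abs]
  refine norm_integral_le_of_norm_le ?_ (ae_of_all _ fun z => ?_)
  · rw [integrable_indicator_iff measurableSet_Icc]
    exact (continuous_const.mul hYc.abs).continuousOn.integrableOn_Icc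
  by_cases hz : K < |z|
  · obtain ⟨h1, h2, h3, h4⟩ := hzero z hz
    have hn : z ∉ Icc (-K) K := fun h => not_lt.2 (abs_le.2 h) hz
    simp [hS, h1, h2, h3, h4, hn]
  rw [indicator_of_mem (show z ∈ Icc (-K) K from abs_le.1 (not_lt.1 hz)), Real.norm_eq_abs]
  obtain ⟨hadd, hdiff⟩ := hposneg (w z)
  set r := max (w z) 0 with hr
  set s := max (-(w z)) 0 with hs
  have hr0 : 0 ≤ r := le_max_right _ _
  have hs0 : 0 ≤ s := le_max_right _ _
  have hT₁ := abs_taylor_one_le hψ hC₂ (z + y) ε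
  have hT₂ := abs_taylor_one_le hψ hC₂ (z + y) (-ε)
  rw [← sub_eq_add_neg, neg_sq] at hT₂
  set A := ψ (z + y + ε) - ψ (z + y) - ε * deriv ψ (z + y)
  set B := ψ (z + y - ε) - ψ (z + y) - -ε * deriv ψ (z + y)
  have hsplit : S z - w (z + y) * Y z * deriv ψ (z + y)
      = (ε⁻¹ * (r * A + s * B) + (w z - w (z + y)) * deriv ψ (z + y)) * Y z := by
    simp only [hS, hp, hq, A, B, ← hr, ← hs]
    rw [← hdiff]
    field_simp
    ring
  have h1 : |ε⁻¹ * (r * A + s * B)| ≤ M * C₂ * ε := by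
    have : |r * A + s * B| ≤ M * (C₂ * ε ^ 2) := by
      calc |r * A + s * B| ≤ |r * A| + |s * B| := abs_add_le _ _
        _ = r * |A| + s * |B| := by rw [abs_mul, abs_mul, abs_of_nonneg hr0, abs_of_nonneg hs0]
        _ ≤ r * (C₂ * ε ^ 2) + s * (C₂ * ε ^ 2) := by gcongr
        _ = |w z| * (C₂ * ε ^ 2) := by rw [← hadd]; ring
        _ ≤ M * (C₂ * ε ^ 2) := by gcongr; exact hwM z
    rw [abs_mul, abs_of_pos (inv_pos.2 hε)]
    calc _ ≤ ε⁻¹ * (M * (C₂ * ε ^ 2)) := by gcongr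
      _ = M * C₂ * ε := by field_simp
  have h2 : |(w z - w (z + y)) * deriv ψ (z + y)| ≤ L * |y| * C₁ := by
    have := hwL z (z + y)
    rw [sub_add_cancel_left, abs_neg] at this
    rw [abs_mul]
    gcongr
    exact hC₁ _
  rw [hsplit, abs_mul]
  gcongr
  exact (abs_add_le _ _).trans (add_le_add h1 h2)

/-- Consistency error of the upwind operator after mollification by a kernel `k`. -/
lemma abs_integral_mollified_sub_le {ε M L C₁ C₂ R ρ K : ℝ} {w ψ k : ℝ → ℝ}
    {Y Y' : BoundedContinuousFunction ℝ ℝ}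
    (hε : 0 < ε) (hw : Continuous w) (hwM : ∀ x, |w x| ≤ M)
    (hwL : ∀ a b, |w a - w b| ≤ L * |a - b|)
    (hY' : ∀ x, Y' x = ε⁻¹ * (Y (x - ε) * max (w (x - ε)) 0 - Y x * |w x|
      + Y (x + ε) * max (-(w (x + ε))) 0))
    (hψ : ContDiff ℝ 2 ψ) (hψR : tsupport ψ ⊆ Metric.closedBall 0 R)
    (hC₁ : ∀ x, |deriv ψ x| ≤ C₁) (hC₂ : ∀ x, |deriv (deriv ψ) x| ≤ C₂)
    (hk : Continuous k) (hkc : HasCompactSupport k) (hkρ : ∀ y, ρ < |y| → k y = 0)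
    (hK : 0 ≤ K) (hRK : R + ρ + ε ≤ K) :
    |∫ x, ((∫ y, Y' (x - y) * k y) * ψ x - w x * (∫ y, Y (x - y) * k y) * deriv ψ x)|
      ≤ (∫ y, |k y|) * ((M * C₂ * ε + L * ρ * C₁) * ∫ x in (-K)..K, |Y x|) := by
  have hψc : HasCompactSupport ψ :=
    (isCompact_closedBall (0:ℝ) R).of_isClosed_subset (isClosed_tsupport ψ) hψR
  have hdψ : Continuous (deriv ψ) := hψ.continuous_deriv (by norm_num)
  have hψcont := hψ.continuous
  have hYc := map_continuous Y
  have hYc' := map_continuous Y'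
  have hC₁0 : 0 ≤ C₁ := (abs_nonneg _).trans (hC₁ 0)
  have hL : 0 ≤ L := by simpa using (abs_nonneg _).trans (hwL 1 0)
  set F : ℝ → ℝ → ℝ := fun x y =>
    k y * (Y' (x - y) * ψ x - w x * Y (x - y) * deriv ψ x) with hF
  have hFc : Continuous (Function.uncurry F) := by
    simp only [hF, Function.uncurry_def]
    fun_prop
  have hFs : HasCompactSupport (Function.uncurry F) := by
    refine HasCompactSupport.intro (hψc.isCompact.prod hkc.isCompact) fun ⟨x, y⟩ hxy => ?_
    rw [mem_prod, not_and_or] at hxy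
    rcases hxy with h | h
    · have h1 := image_eq_zero_of_notMem_tsupport h
      have h2 := image_eq_zero_of_notMem_tsupport
        (fun h' => h (tsupport_deriv_subset (𝕜 := ℝ) h'))
      simp only at h1 h2
      simp [hF, h1, h2]
    · have h1 := image_eq_zero_of_notMem_tsupport h
      simp only at h1
      simp [hF, h1]
  have hint : ∀ {Z : ℝ → ℝ}, Continuous Z → ∀ x, Integrable fun y => Z (x - y) * k y :=
    fun hZ x => ((hZ.comp (continuous_const.sub continuous_id)).mul
      hk).integrable_of_hasCompactSupport hkc.mul_left
  have hswap : ∫ x, ((∫ y, Y' (x - y) * k y) * ψ x - w x * (∫ y, Y (x - y) * k y) * deriv ψ x)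
      = ∫ y, k y * ∫ x, (Y' (x - y) * ψ x - w x * Y (x - y) * deriv ψ x) := by
    simp_rw [← integral_const_mul]
    rw [← integral_integral_swap_of_hasCompactSupport hFc hFs]
    refine integral_congr_ae (ae_of_all _ fun x => ?_)
    simp only [hF]
    rw [integral_const_mul, mul_right_comm (w x), mul_comm _ (∫ y, Y (x - y) * k y),
      ← integral_mul_const, ← integral_mul_const,
      ← integral_sub ((hint hYc' x).mul_const _) ((hint hYc x).mul_const _)]
    refine integral_congr_ae (ae_of_all _ fun y => ?_)
    ring
  rw [hswap, ← integral_mul_const, ← Real.norm_eq_abs]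
  refine norm_integral_le_of_norm_le
    ((hk.abs.integrable_of_hasCompactSupport hkc.abs).mul_const _) (ae_of_all _ fun y => ?_)
  rw [norm_mul, Real.norm_eq_abs, Real.norm_eq_abs]
  rcases lt_or_ge ρ |y| with hy | hy
  · simp [hkρ y hy]
  have hYn : 0 ≤ ∫ x in (-K)..K, |Y x| :=
    intervalIntegral.integral_nonneg (by linarith) fun _ _ => abs_nonneg _
  gcongr
  refine (abs_integral_upwind_sub_le hε hw hwM hwL hY' hψ hψR hC₁ hC₂ hK (by linarith)).trans ?_
  gcongr

/-- Convolution with a fixed kernel commutes with the time derivative. -/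
lemma hasDerivWithinAt_integral_comp_sub_mul {k : ℝ → ℝ} (hk : Integrable k)
    {X : ℝ → BoundedContinuousFunction ℝ ℝ} {X' : BoundedContinuousFunction ℝ ℝ} {s : Set ℝ}
    {t : ℝ} (hX : HasDerivWithinAt X X' s t) (x : ℝ) :
    HasDerivWithinAt (fun τ => ∫ y, X τ (x - y) * k y) (∫ y, X' (x - y) * k y) s t := by
  have hint : ∀ Z : BoundedContinuousFunction ℝ ℝ, Integrable fun y => Z (x - y) * k y :=
    fun Z => hk.bdd_mul (c := ‖Z‖)
      ((map_continuous Z).comp (continuous_const.sub continuous_id)).aestronglyMeasurable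
      (ae_of_all _ fun y => Z.norm_coe_le_norm _)
  let T : BoundedContinuousFunction ℝ ℝ →ₗ[ℝ] ℝ :=
    { toFun := fun Z => ∫ y, Z (x - y) * k y
      map_add' := fun Z W => by
        rw [← integral_add (hint Z) (hint W)]
        simp only [BoundedContinuousFunction.add_apply, add_mul]
      map_smul' := fun c Z => by
        rw [RingHom.id_apply, smul_eq_mul, ← integral_const_mul]
        simp only [BoundedContinuousFunction.smul_apply, smul_eq_mul, mul_assoc] }
  have hT : ∀ Z, ‖T Z‖ ≤ (∫ y, |k y|) * ‖Z‖ := fun Z => by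
    rw [← integral_mul_const]
    refine norm_integral_le_of_norm_le (hk.abs.mul_const _) (ae_of_all _ fun y => ?_)
    rw [norm_mul, mul_comm, Real.norm_eq_abs (k y)]
    gcongr
    exact Z.norm_coe_le_norm _
  exact (T.mkContinuous _ hT).hasFDerivAt.comp_hasDerivWithinAt t hX

/-- Lemma 2: the family `(u_ε, v_ε)`, with `v_ε = X_ε * φ_{ε^α}`, is a weak asymptotic
method for `∂ₜv + ∂ₓ(uv) = 0`: for every test function `ψ` and every `δ > 0`,
`sup_{t∈[0,δ]} |∫ (∂ₜv_ε ψ − u_ε v_ε ψ') dx| → 0` as `ε → 0`, provided `0 < β < α`. -/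
theorem stmt4
    (φ : ℝ → ℝ) (hφ : ContDiff ℝ (⊤ : ℕ∞) φ) (hφc : HasCompactSupport φ) (hφ1 : ∫ x, φ x = 1)
    (u : ℝ → ℝ → ℝ → ℝ) -- `u ε x t`
    (hu_cont : ∀ ε ∈ Ioo (0:ℝ) 1,
      ContinuousOn (fun p : ℝ × ℝ => u ε p.1 p.2) (univ ×ˢ Ici 0))
    (hu_curve : ∀ ε ∈ Ioo (0:ℝ) 1, ∃ U : ℝ → BoundedContinuousFunction ℝ ℝ,
      ContinuousOn U (Ici 0) ∧ ∀ t ∈ Ici (0:ℝ), ∀ x : ℝ, U t x = u ε x t)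
    (hu_per : ∀ ε ∈ Ioo (0:ℝ) 1, ∀ x : ℝ, ∀ t ∈ Ici (0:ℝ), u ε (x + 2*π) t = u ε x t)
    (M₁ : ℝ) (hM₁ : 0 < M₁)
    (hu_bdd : ∀ ε ∈ Ioo (0:ℝ) 1, ∀ x : ℝ, ∀ t ∈ Ici (0:ℝ), |u ε x t| ≤ M₁)
    (hu_diff : ∀ ε ∈ Ioo (0:ℝ) 1, ∀ t ∈ Ici (0:ℝ), Differentiable ℝ (fun y => u ε y t))
    (β : ℝ) (hβ : 0 < β)
    (hu_dx : ∀ δ > (0:ℝ), ∃ Cδ > (0:ℝ), ∀ ε ∈ Ioo (0:ℝ) 1, ∀ x : ℝ, ∀ t ∈ Icc (0:ℝ) δ,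
      |deriv (fun y => u ε y t) x| ≤ Cδ / ε ^ β)
    (v₀ : ℝ → ℝ → ℝ) -- `v₀ ε x`
    (hv₀c : ∀ ε ∈ Ioo (0:ℝ) 1, Continuous (v₀ ε))
    (hv₀p : ∀ ε ∈ Ioo (0:ℝ) 1, ∀ x : ℝ, v₀ ε (x + 2*π) = v₀ ε x)
    (C₀ : ℝ) (hv₀i : ∀ ε ∈ Ioo (0:ℝ) 1, (∫ x in (-π)..π, |v₀ ε x|) ≤ C₀)
    (X : ℝ → ℝ → BoundedContinuousFunction ℝ ℝ) -- `X ε t`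
    (hX : ∀ ε ∈ Ioo (0:ℝ) 1, IsDiscreteTransportSol ε (u ε) (X ε))
    (hX0 : ∀ ε ∈ Ioo (0:ℝ) 1, ∀ x : ℝ, X ε 0 x = v₀ ε x)
    (hXper : ∀ ε ∈ Ioo (0:ℝ) 1, ∀ t ∈ Ici (0:ℝ), ∀ x : ℝ, X ε t (x + 2*π) = X ε t x)
    (α : ℝ) (hα : α ∈ Ioc (0:ℝ) 1) (hβα : β < α)
    (v : ℝ → ℝ → ℝ → ℝ) -- `v ε x t`, the mollified family
    (hv : ∀ ε ∈ Ioo (0:ℝ) 1, ∀ x t : ℝ,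
      v ε x t = ∫ y, X ε t (x - y) * ((ε ^ α)⁻¹ * φ (y / ε ^ α)))
    (ψ : ℝ → ℝ) (hψ : ContDiff ℝ (⊤ : ℕ∞) ψ) (hψc : HasCompactSupport ψ)
    (δ : ℝ) (hδ : 0 < δ) :
    ∀ η > (0:ℝ), ∃ ε₀ > (0:ℝ), ∀ ε ∈ Ioo (0:ℝ) 1, ε < ε₀ → ∀ t ∈ Icc (0:ℝ) δ,
      |∫ x, (derivWithin (fun s => v ε x s) (Ici 0) t * ψ x
        - u ε x t * v ε x t * deriv ψ x)| < η := by
  intro η hη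
  obtain ⟨C, hC, hderivC⟩ := hu_dx δ hδ
  have hψ2 : ContDiff ℝ 2 ψ := contDiff_infty.1 hψ 2
  have hdψ : ContDiff ℝ 1 (deriv ψ) := ContDiff.iterate_deriv' 1 1 hψ2
  obtain ⟨C₁, hC₁⟩ := hψc.deriv.exists_bound_of_continuous hdψ.continuous
  obtain ⟨C₂, hC₂⟩ := hψc.deriv.deriv.exists_bound_of_continuous
    (hdψ.continuous_deriv le_rfl)
  obtain ⟨R, hR⟩ := hψc.isCompact.isBounded.subset_closedBall 0
  obtain ⟨ρ, hρ0, hρ⟩ := hφc.isCompact.isBounded.subset_closedBall_lt 0 0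
  have hφρ : ∀ y, ρ < |y| → φ y = 0 := fun y hy => by
    refine image_eq_zero_of_notMem_tsupport fun h => ?_
    have := hρ h
    rw [mem_closedBall_zero_iff, Real.norm_eq_abs] at this
    linarith
  obtain ⟨n, hn⟩ := exists_nat_ge ((R + ρ + 1) / (2 * π))
  have hK : R + ρ + 1 ≤ n * (2 * π) := (div_le_iff₀ (by positivity)).1 hn
  have hC₁0 : 0 ≤ C₁ := (norm_nonneg _).trans (hC₁ 0)
  have hC₂0 : 0 ≤ C₂ := (norm_nonneg _).trans (hC₂ 0)
  have hlim : Filter.Tendsto (fun ε : ℝ => (∫ y, |φ y|) *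
      ((M₁ * C₂ * ε + C * ρ * C₁ * ε ^ (α - β)) * (2 * n * C₀))) (nhds 0) (nhds 0) := by
    have hpow : Filter.Tendsto (fun ε : ℝ => ε ^ (α - β)) (nhds 0) (nhds 0) := by
      have := (Real.continuousAt_rpow_const 0 (α - β) (Or.inr (by linarith))).tendsto
      rwa [Real.zero_rpow (by linarith)] at this
    have := ((((Filter.tendsto_id (α := ℝ) (x := nhds 0)).const_mul (M₁ * C₂)).add
      (hpow.const_mul (C * ρ * C₁))).mul_const (2 * n * C₀)).const_mul (∫ y, |φ y|)
    simpa using this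
  obtain ⟨ε₀, hε₀, hball⟩ := Metric.eventually_nhds_iff.1 (hlim.eventually_lt_const hη)
  refine ⟨ε₀, hε₀, fun ε hε hεε₀ t ht => ?_⟩
  have hε0 : 0 < ε := hε.1
  have ht0 : t ∈ Ici (0:ℝ) := ht.1
  have hη' := hball (y := ε) (by rwa [dist_zero_right, Real.norm_eq_abs, abs_of_pos hε0])
  refine lt_of_le_of_lt ?_ hη'
  set h := ε ^ α with hh
  have hh0 : 0 < h := rpow_pos_of_pos hε0 α
  have hh1 : h ≤ 1 := rpow_le_one hε0.le hε.2.le hα.1.le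
  set k : ℝ → ℝ := fun y => h⁻¹ * φ (y / h) with hk
  have hφcont := hφ.continuous
  have hkcont : Continuous k := by fun_prop
  have hkρ : ∀ y, ρ * h < |y| → k y = 0 := fun y hy => by
    have : φ (y / h) = 0 := hφρ _ (by rwa [abs_div, abs_of_pos hh0, lt_div_iff₀ hh0])
    simp [hk, this]
  have hkc : HasCompactSupport k :=
    HasCompactSupport.intro (isCompact_closedBall (0:ℝ) (ρ * h)) fun y hy => hkρ y (by
      rwa [mem_closedBall_zero_iff, Real.norm_eq_abs, not_le] at hy)
  have hkint : ∫ y, |k y| = ∫ y, |φ y| := by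
    simp only [hk, abs_mul, abs_inv, abs_of_pos hh0]
    rw [integral_const_mul, Measure.integral_comp_div (fun y => |φ y|), abs_of_pos hh0,
      smul_eq_mul, inv_mul_cancel_left₀ hh0.ne']
  have hcontr := (hX ε hε).periodL1_le hε0 hM₁ (fun s hs => (hu_diff ε hε s hs).continuous)
    (hu_bdd ε hε) (fun s hs x => hu_per ε hε x s hs) (hXper ε hε) ht.1
  have hL1 : periodL1 (X ε t) ≤ C₀ := hcontr.trans (by
    simpa only [periodL1, hX0 ε hε] using hv₀i ε hε)
  obtain ⟨X', -, hX', hXeq⟩ := hX ε hε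
  have hdv : ∀ x, derivWithin (fun s => v ε x s) (Ici 0) t = ∫ y, X' t (x - y) * k y := by
    intro x
    simp only [hv ε hε]
    exact (hasDerivWithinAt_integral_comp_sub_mul
      (hkcont.integrable_of_hasCompactSupport hkc) (hX' t ht0) x).derivWithin
      (uniqueDiffOn_Ici 0 t ht0)
  simp only [hdv]
  simp only [hv ε hε]
  have huL : ∀ a b, |u ε a t - u ε b t| ≤ C / ε ^ β * |a - b| := fun a b =>
    convex_univ.norm_image_sub_le_of_norm_deriv_le (f := fun y => u ε y t)
      (fun z _ => hu_diff ε hε t ht0 z) (fun z _ => hderivC ε hε z t ht) (mem_univ b) (mem_univ a)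
  have hρh : ρ * h ≤ ρ := mul_le_of_le_one_right hρ0.le hh1
  refine (abs_integral_mollified_sub_le hε0 (hu_diff ε hε t ht0).continuous
    (fun x => hu_bdd ε hε x t ht0) huL (hXeq t ht0) hψ2 hR hC₁ hC₂ hkcont hkc hkρ
    (K := n * (2 * π)) (by positivity) (by linarith [hε.2])).trans ?_
  rw [hkint, integral_abs_eq_mul_periodL1 (hXper ε hε t ht0)]
  have hrate : C / ε ^ β * (ρ * h) * C₁ = C * ρ * C₁ * ε ^ (α - β) := by
    rw [rpow_sub hε0, hh]; ring
  rw [hrate]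
  gcongr
end

section
/- (Lemma 3.) Let n ≥ 1 be an integer. Assume hypotheses (i)–(iv) of the construction: (u_ε) continuous, bounded by M₁, 2π-periodic in x; (v₀ε) continuous 2π-periodic with ∫_{−π}^{π}|v₀ε| ≤ C₀; X_ε the 2π-periodic solution of the discrete transport ODE with velocity u_ε and step ε with X_ε(·,0) = v₀ε; α ∈ (0,1] and v_ε = X_ε * φ_{ε^α}. Assume further that (w₀ε)_{ε∈(0,1)} are continuous 2π-periodic functions with ∫_{−π}^{π}|w₀ε(x)|dx ≤ C₀', and that for each ε ∈ (0,1), w_ε is a continuously differentiable curve in C_b(ℝ), 2π-periodic in x, with w_ε(·,0) = w₀ε and ∂ₜw_ε(x,t) = (1/ε)[w_ε(x−ε,t)u_ε(x−ε,t)⁺ − w_ε(x,t)|u_ε(x,t)| + w_ε(x+ε,t)u_ε(x+ε,t)⁻] − n·v_ε(x,t)^{n−1}·∂ₓv_ε(x,t). Then for every δ > 0 there is a constant C > 0 such that for all ε ∈ (0,1) and all t ∈ [0,δ], ∫_{−π}^{π}|w_ε(x,t)|dx ≤ C/ε^{(n+1)α}. -/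
open MeasureTheory Set Real

/-- An explicit Euler step of the discrete transport ODE does not increase the `L¹` norm over a
period, provided the step size satisfies the CFL condition. -/
lemma intervalIntegral_abs_euler_step_le {ε h T b : ℝ} {a f : ℝ → ℝ} (hε : 0 < ε) (hh : 0 ≤ h)
    (hT : 0 ≤ T) (ha : Continuous a) (hf : Continuous f) (hap : Function.Periodic a T)
    (hfp : Function.Periodic f T) (hcfl : ∀ x, h * |a x| ≤ ε) :
    (∫ x in b..b + T, |f x + h * (ε⁻¹ * (f (x - ε) * max (a (x - ε)) 0 - f x * |a x|
      + f (x + ε) * max (-(a (x + ε))) 0))|) ≤ ∫ x in b..b + T, |f x| := by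
  set c := h * ε⁻¹ with hc
  have hc0 : 0 ≤ c := by positivity
  set P : ℝ → ℝ := fun x => |f x| * max (a x) 0 with hP
  set Q : ℝ → ℝ := fun x => |f x| * max (-(a x)) 0 with hQ
  have hPc : Continuous P := by fun_prop
  have hQc : Continuous Q := by fun_prop
  have hPp : Function.Periodic P T := fun x => by simp only [hP, hfp x, hap x]
  have hQp : Function.Periodic Q T := fun x => by simp only [hQ, hfp x, hap x]
  have hPs : ∫ x in b..b + T, P (x - ε) = ∫ x in b..b + T, P x := by
    rw [intervalIntegral.integral_comp_sub_right P ε,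
      show b + T - ε = (b - ε) + T by ring, hPp.intervalIntegral_add_eq (b - ε) b]
  have hQs : ∫ x in b..b + T, Q (x + ε) = ∫ x in b..b + T, Q x := by
    rw [intervalIntegral.integral_comp_add_right Q ε,
      show b + T + ε = (b + ε) + T by ring, hQp.intervalIntegral_add_eq (b + ε) b]
  have hpt : ∀ x, |f x + h * (ε⁻¹ * (f (x - ε) * max (a (x - ε)) 0 - f x * |a x|
      + f (x + ε) * max (-(a (x + ε))) 0))|
      ≤ |f x| + c * (P (x - ε) - (P x + Q x) + Q (x + ε)) := by
    intro x
    have hca : 0 ≤ 1 - c * |a x| := by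
      have := hcfl x
      have : c * |a x| ≤ 1 := by
        rw [hc, show h * ε⁻¹ * |a x| = h * |a x| / ε by ring]
        exact (div_le_one hε).2 this
      linarith
    have hPQ : P x + Q x = |f x| * |a x| := by
      simp only [hP, hQ, ← mul_add]
      rcases le_total 0 (a x) with h0 | h0
      · rw [max_eq_left h0, max_eq_right (by linarith), abs_of_nonneg h0, add_zero]
      · rw [max_eq_right h0, max_eq_left (by linarith), abs_of_nonpos h0, zero_add]
    calc _ = |f x * (1 - c * |a x|) + c * (f (x - ε) * max (a (x - ε)) 0)
          + c * (f (x + ε) * max (-(a (x + ε))) 0)| := by congr 1; rw [hc]; ring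
      _ ≤ |f x * (1 - c * |a x|)| + |c * (f (x - ε) * max (a (x - ε)) 0)|
          + |c * (f (x + ε) * max (-(a (x + ε))) 0)| := abs_add_three _ _ _
      _ = |f x| * (1 - c * |a x|) + c * P (x - ε) + c * Q (x + ε) := by
        simp only [abs_mul, abs_of_nonneg hca, abs_of_nonneg hc0, hP, hQ,
          abs_of_nonneg (le_max_right _ (0 : ℝ))]
      _ = _ := by rw [hPQ]; ring
  refine (intervalIntegral.integral_mono (by linarith)
    (Continuous.intervalIntegrable (by fun_prop) _ _)
    (Continuous.intervalIntegrable (by fun_prop) _ _) hpt).trans_eq ?_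
  have hi : ∀ g : ℝ → ℝ, Continuous g → IntervalIntegrable g volume b (b + T) :=
    fun g hg => hg.intervalIntegrable _ _
  rw [intervalIntegral.integral_add (hi _ (by fun_prop)) (hi _ (by fun_prop)),
    intervalIntegral.integral_const_mul,
    intervalIntegral.integral_add (hi _ (by fun_prop)) (hi _ (by fun_prop)),
    intervalIntegral.integral_sub (hi _ (by fun_prop)) (hi _ (by fun_prop)),
    intervalIntegral.integral_add (hi _ hPc) (hi _ hQc), hPs, hQs]
  ring

/-- `L¹` stability over a period for the discrete transport ODE with a bounded source. -/
lemma intervalIntegral_abs_le_of_discreteTransport {ε M G T b : ℝ} {u : ℝ → ℝ → ℝ}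
    {W W' : ℝ → BoundedContinuousFunction ℝ ℝ} (hε : 0 < ε) (hT : 0 < T) (hM : 0 < M)
    (hu : ∀ t ∈ Ici (0:ℝ), Continuous fun x => u x t)
    (hup : ∀ t ∈ Ici (0:ℝ), Function.Periodic (fun x => u x t) T)
    (huM : ∀ t ∈ Ici (0:ℝ), ∀ x, |u x t| ≤ M)
    (hW : ∀ t ∈ Ici (0:ℝ), HasDerivWithinAt W (W' t) (Ici 0) t)
    (hWp : ∀ t ∈ Ici (0:ℝ), Function.Periodic (W t) T) {δ : ℝ}
    (hG : ∀ t ∈ Ico 0 δ, ∀ x, |W' t x - ε⁻¹ * (W t (x - ε) * max (u (x - ε) t) 0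
        - W t x * |u x t| + W t (x + ε) * max (-(u (x + ε) t)) 0)| ≤ G) :
    ∀ t ∈ Icc 0 δ, (∫ x in b..b + T, |W t x|) ≤ (∫ x in b..b + T, |W 0 x|) + T * G * t := by
  have hcont : Continuous fun F : BoundedContinuousFunction ℝ ℝ => ∫ x in b..b + T, |F x| := by
    refine intervalIntegral.continuous_parametric_intervalIntegral_of_continuous' ?_ _ _
    exact continuous_abs.comp continuous_eval
  refine image_le_of_liminf_slope_right_le_deriv_boundary (B' := fun _ => T * G)
    (f := fun t => ∫ x in b..b + T, |W t x|) ?_ (by simp) (by fun_prop) ?_ ?_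
  · exact hcont.comp_continuousOn fun t ht =>
      ((hW t ht.1).continuousWithinAt).mono fun s hs => hs.1
  · intro t _
    simpa using (((hasDerivAt_id t).const_mul (T * G)).const_add
      (∫ x in b..b + T, |W 0 x|)).hasDerivWithinAt (s := Ici t)
  · intro t ht r hr
    have ht0 : t ∈ Ici (0:ℝ) := ht.1
    obtain ⟨η, hη, hηr⟩ : ∃ η > 0, T * (G + η) < r := by
      refine ⟨(r - T * G) / (2 * T), div_pos (by linarith) (by linarith), ?_⟩
      have : T * (G + (r - T * G) / (2 * T)) = T * G + (r - T * G) / 2 := by field_simp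
      linarith
    have hder : HasDerivWithinAt W (W' t) (Ioi t) t :=
      (hW t ht0).mono fun s hs => le_trans ht.1 (le_of_lt hs)
    have hlo := (hasDerivWithinAt_iff_isLittleO.1 hder).bound hη
    refine Filter.Eventually.frequently ?_
    have hsmall : ∀ᶠ z in nhdsWithin t (Ioi t), z < t + ε / M :=
      nhdsWithin_le_nhds (Iio_mem_nhds (by have := div_pos hε hM; linarith))
    filter_upwards [hlo, hsmall, self_mem_nhdsWithin] with z hz hzs hzt
    have hzt' : 0 < z - t := sub_pos.2 hzt
    set A : ℝ → ℝ := fun x => ε⁻¹ * (W t (x - ε) * max (u (x - ε) t) 0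
        - W t x * |u x t| + W t (x + ε) * max (-(u (x + ε) t)) 0) with hA
    have hut := hu t ht0
    have hut1 : Continuous fun x => u (x - ε) t := hut.comp (continuous_id.sub continuous_const)
    have hut2 : Continuous fun x => u (x + ε) t := hut.comp (continuous_id.add continuous_const)
    have hAc : Continuous A := by fun_prop
    have hpt : ∀ x, |W z x| ≤ |W t x + (z - t) * A x| + (z - t) * (G + η) := by
      intro x
      have h1 : |W z x - W t x - (z - t) * W' t x| ≤ η * (z - t) := by
        have h2 := (W z - W t - (z - t) • W' t).norm_coe_le_norm x
        rw [Real.norm_of_nonneg hzt'.le] at hz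
        simpa using h2.trans hz
      have h3 : |(z - t) * (W' t x - A x)| ≤ (z - t) * G := by
        rw [abs_mul, abs_of_pos hzt']
        exact mul_le_mul_of_nonneg_left (hG t ht x) hzt'.le
      calc |W z x| = |(W t x + (z - t) * A x) + (W z x - W t x - (z - t) * W' t x)
            + (z - t) * (W' t x - A x)| := by congr 1; ring
        _ ≤ _ := abs_add_three _ _ _
        _ ≤ _ := by linarith
    have hstep := intervalIntegral_abs_euler_step_le (b := b) hε hzt'.le hT.le hut (W t).continuous
      (hup t ht0) (hWp t ht0) (fun x => by
        have : (z - t) * M ≤ ε := by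
          rw [← le_div_iff₀ hM]; linarith
        exact (mul_le_mul_of_nonneg_left (huM t ht0 x) hzt'.le).trans this)
    have hint : (∫ x in b..b + T, |W z x|)
        ≤ (∫ x in b..b + T, |W t x|) + T * ((z - t) * (G + η)) := by
      refine (intervalIntegral.integral_mono (by linarith)
        (Continuous.intervalIntegrable (by fun_prop) _ _)
        (Continuous.intervalIntegrable (by fun_prop) _ _) hpt).trans ?_
      rw [intervalIntegral.integral_add (Continuous.intervalIntegrable (by fun_prop) _ _)
        (Continuous.intervalIntegrable (by fun_prop) _ _), intervalIntegral.integral_const]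
      simp only [add_sub_cancel_left, smul_eq_mul]
      linarith
    rw [slope_def_field]
    refine lt_of_le_of_lt ?_ hηr
    rw [div_le_iff₀ hzt']
    linarith

/-- Sup bound for the convolution of a periodic function with a compactly supported kernel of
scale `h ≤ 1` in terms of the `L¹` norm over a period. -/
lemma abs_integral_mul_comp_div_le {T K h : ℝ} {N : ℕ} {f ψ : ℝ → ℝ} (hT : 0 < T)
    (hf : Continuous f) (hfp : Function.Periodic f T) (hψK : ∀ x, |ψ x| ≤ K)
    (hψs : ∀ x, N * T < |x| → ψ x = 0) (hh : 0 < h) (hh1 : h ≤ 1) (b x : ℝ) :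
    |∫ y, f (x - y) * ψ (y / h)| ≤ K * (2 * N * ∫ y in b..b + T, |f y|) := by
  set R := N * T with hR
  have hR0 : 0 ≤ R := by positivity
  have hK : 0 ≤ K := (abs_nonneg _).trans (hψK 0)
  have hbd : ∀ y, ‖f (x - y) * ψ (y / h)‖ ≤ (Icc (-R) R).indicator (fun y => K * |f (x - y)|) y := by
    intro y
    by_cases hy : y ∈ Icc (-R) R
    · rw [indicator_of_mem hy, Real.norm_eq_abs, abs_mul, mul_comm]
      exact mul_le_mul_of_nonneg_right (hψK _) (abs_nonneg _)
    · have hy' : R < |y / h| := by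
        have : R < |y| := by
          by_contra hcon
          exact hy (abs_le.1 (not_lt.1 hcon))
        rw [abs_div, abs_of_pos hh, lt_div_iff₀ hh]
        nlinarith
      rw [hψs _ hy', indicator_of_notMem hy]
      simp
  have hint : IntegrableOn (fun y => K * |f (x - y)|) (Icc (-R) R) :=
    Continuous.integrableOn_Icc (by fun_prop)
  rw [← Real.norm_eq_abs]
  refine (norm_integral_le_of_norm_le (hint.integrable_indicator measurableSet_Icc)
    (Filter.Eventually.of_forall hbd)).trans_eq ?_
  rw [integral_indicator measurableSet_Icc, integral_Icc_eq_integral_Ioc,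
    ← intervalIntegral.integral_of_le (by linarith), intervalIntegral.integral_const_mul]
  congr 1
  have habs : Function.Periodic (fun y => |f y|) T := fun y => by simp only [hfp y]
  rw [intervalIntegral.integral_comp_sub_left (fun y => |f y|) x,
    show x - -R = (x - R) + ((2 * N : ℕ) : ℤ) • T by
      rw [natCast_zsmul, nsmul_eq_mul]; push_cast; rw [hR]; ring,
    habs.intervalIntegral_add_zsmul_eq _ _ (fun _ _ => Continuous.intervalIntegrable (by fun_prop) _ _)]
  rw [habs.intervalIntegral_add_eq (x - R) b]
  simp

/-- A mollification is differentiable, and the derivative falls on the kernel. -/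
lemma hasDerivAt_integral_mul_comp_div {h : ℝ} {f φ : ℝ → ℝ} (hh : 0 < h) (hf : Continuous f)
    (hφ : ContDiff ℝ 1 φ) (hφc : HasCompactSupport φ) (x : ℝ) :
    HasDerivAt (fun z => ∫ y, f (z - y) * (h⁻¹ * φ (y / h)))
      (∫ y, f (x - y) * (h⁻¹ * (h⁻¹ * deriv φ (y / h)))) x := by
  set ψ : ℝ → ℝ := fun y => h⁻¹ * φ (y / h) with hψ
  have hψd : ∀ y, deriv ψ y = h⁻¹ * (h⁻¹ * deriv φ (y / h)) := by
    intro y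
    have h1 : HasDerivAt φ (deriv φ (y / h)) (y / h) :=
      (hφ.differentiable one_ne_zero _).hasDerivAt
    have h2 := (h1.comp y ((hasDerivAt_id y).div_const h)).const_mul h⁻¹
    exact h2.deriv.trans (by simp only [one_div]; ring)
  have hψs : HasCompactSupport ψ := by
    have : HasCompactSupport fun y => φ (y / h) := by
      simpa [div_eq_mul_inv, Function.comp_def] using
        hφc.comp_homeomorph (Homeomorph.mulRight₀ h⁻¹ (inv_ne_zero hh.ne'))
    exact this.mul_left
  have hψ1 : ContDiff ℝ 1 ψ := contDiff_const.mul (hφ.comp (contDiff_id.div_const h))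
  have key := hψs.hasDerivAt_convolution_left (μ := volume) (ContinuousLinearMap.mul ℝ ℝ) hψ1
    hf.locallyIntegrable x
  simp only [convolution_def, ContinuousLinearMap.mul_apply', hψd] at key
  have e1 : (MeasureTheory.convolution ψ f (ContinuousLinearMap.mul ℝ ℝ) volume)
      = fun z => ∫ y, f (z - y) * ψ y := by
    funext z
    simp only [convolution_def, ContinuousLinearMap.mul_apply', mul_comm]
  rw [e1] at key
  simpa only [mul_comm (f _)] using key

/-- Lemma 3: with `v_ε = X_ε * φ_{ε^α}` and `w_ε` the solution of the discrete transport
ODE with source `−n v_ε^{n−1} ∂ₓv_ε`, one has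
`∫_{−π}^{π} |w_ε(x,t)| dx ≤ C/ε^{(n+1)α}` for `t ∈ [0,δ]`, uniformly in `ε ∈ (0,1)`. -/
theorem stmt5 (n : ℕ) (hn : 1 ≤ n)
    (φ : ℝ → ℝ) (hφ : ContDiff ℝ (⊤ : ℕ∞) φ) (hφc : HasCompactSupport φ) (hφ1 : ∫ x, φ x = 1)
    (u : ℝ → ℝ → ℝ → ℝ) -- `u ε x t`
    (hu_cont : ∀ ε ∈ Ioo (0:ℝ) 1,
      ContinuousOn (fun p : ℝ × ℝ => u ε p.1 p.2) (univ ×ˢ Ici 0))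
    (hu_curve : ∀ ε ∈ Ioo (0:ℝ) 1, ∃ U : ℝ → BoundedContinuousFunction ℝ ℝ,
      ContinuousOn U (Ici 0) ∧ ∀ t ∈ Ici (0:ℝ), ∀ x : ℝ, U t x = u ε x t)
    (hu_per : ∀ ε ∈ Ioo (0:ℝ) 1, ∀ x : ℝ, ∀ t ∈ Ici (0:ℝ), u ε (x + 2*π) t = u ε x t)
    (M₁ : ℝ) (hM₁ : 0 < M₁)
    (hu_bdd : ∀ ε ∈ Ioo (0:ℝ) 1, ∀ x : ℝ, ∀ t ∈ Ici (0:ℝ), |u ε x t| ≤ M₁)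
    (v₀ : ℝ → ℝ → ℝ) -- `v₀ ε x`
    (hv₀c : ∀ ε ∈ Ioo (0:ℝ) 1, Continuous (v₀ ε))
    (hv₀p : ∀ ε ∈ Ioo (0:ℝ) 1, ∀ x : ℝ, v₀ ε (x + 2*π) = v₀ ε x)
    (C₀ : ℝ) (hv₀i : ∀ ε ∈ Ioo (0:ℝ) 1, (∫ x in (-π)..π, |v₀ ε x|) ≤ C₀)
    (X : ℝ → ℝ → BoundedContinuousFunction ℝ ℝ) -- `X ε t`
    (hX : ∀ ε ∈ Ioo (0:ℝ) 1, IsDiscreteTransportSol ε (u ε) (X ε))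
    (hX0 : ∀ ε ∈ Ioo (0:ℝ) 1, ∀ x : ℝ, X ε 0 x = v₀ ε x)
    (hXper : ∀ ε ∈ Ioo (0:ℝ) 1, ∀ t ∈ Ici (0:ℝ), ∀ x : ℝ, X ε t (x + 2*π) = X ε t x)
    (α : ℝ) (hα : α ∈ Ioc (0:ℝ) 1)
    (v : ℝ → ℝ → ℝ → ℝ) -- `v ε x t`, the mollified family
    (hv : ∀ ε ∈ Ioo (0:ℝ) 1, ∀ x t : ℝ,
      v ε x t = ∫ y, X ε t (x - y) * ((ε ^ α)⁻¹ * φ (y / ε ^ α)))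
    (w₀ : ℝ → ℝ → ℝ) -- `w₀ ε x`
    (hw₀c : ∀ ε ∈ Ioo (0:ℝ) 1, Continuous (w₀ ε))
    (hw₀p : ∀ ε ∈ Ioo (0:ℝ) 1, ∀ x : ℝ, w₀ ε (x + 2*π) = w₀ ε x)
    (C₀' : ℝ) (hw₀i : ∀ ε ∈ Ioo (0:ℝ) 1, (∫ x in (-π)..π, |w₀ ε x|) ≤ C₀')
    (w : ℝ → ℝ → BoundedContinuousFunction ℝ ℝ) -- `w ε t`
    (hw0 : ∀ ε ∈ Ioo (0:ℝ) 1, ∀ x : ℝ, w ε 0 x = w₀ ε x)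
    (hwper : ∀ ε ∈ Ioo (0:ℝ) 1, ∀ t ∈ Ici (0:ℝ), ∀ x : ℝ, w ε t (x + 2*π) = w ε t x)
    (hw : ∀ ε ∈ Ioo (0:ℝ) 1, ∃ w' : ℝ → BoundedContinuousFunction ℝ ℝ,
      ContinuousOn w' (Ici 0) ∧
      (∀ t ∈ Ici (0:ℝ), HasDerivWithinAt (w ε) (w' t) (Ici 0) t) ∧
      (∀ t ∈ Ici (0:ℝ), ∀ x : ℝ,
        w' t x = ε⁻¹ * (w ε t (x - ε) * max (u ε (x - ε) t) 0
          - w ε t x * |u ε x t| + w ε t (x + ε) * max (-(u ε (x + ε) t)) 0)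
          - (n : ℝ) * (v ε x t) ^ (n - 1) * deriv (fun z => v ε z t) x)) :
    ∀ δ > (0:ℝ), ∃ C > (0:ℝ), ∀ ε ∈ Ioo (0:ℝ) 1, ∀ t ∈ Icc (0:ℝ) δ,
      (∫ x in (-π)..π, |w ε t x|) ≤ C / ε ^ (((n : ℝ) + 1) * α) := by
  have hT : (0:ℝ) < 2 * π := by positivity
  have hend : -π + 2 * π = π := by ring
  have hφ' : ContDiff ℝ 1 φ := hφ.of_le (by exact_mod_cast le_top)
  have hdc : Continuous (deriv φ) := hφ'.continuous_deriv le_rfl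
  obtain ⟨K, hK⟩ := hφc.exists_bound_of_continuous hφ.continuous
  obtain ⟨K', hK'⟩ := hφc.deriv.exists_bound_of_continuous hdc
  have hK0 : 0 ≤ K := (norm_nonneg _).trans (hK 0)
  have hK0' : 0 ≤ K' := (norm_nonneg _).trans (hK' 0)
  obtain ⟨R, hR⟩ := hφc.isCompact.isBounded.exists_norm_le
  obtain ⟨N, hN⟩ := exists_nat_ge (R / (2 * π))
  rw [div_le_iff₀ hT] at hN
  have hout : ∀ x, N * (2 * π) < |x| → x ∉ tsupport φ := fun x hx hmem =>
    absurd (hR x hmem) (not_le.2 (hN.trans_lt hx))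
  have hs : ∀ x, N * (2 * π) < |x| → φ x = 0 := fun x hx => image_eq_zero_of_notMem_tsupport (hout x hx)
  have hs' : ∀ x, N * (2 * π) < |x| → deriv φ x = 0 := fun x hx => by
    by_contra hne
    exact hout x hx (support_deriv_subset hne)
  have huc : ∀ ε ∈ Ioo (0:ℝ) 1, ∀ t ∈ Ici (0:ℝ), Continuous fun x => u ε x t := by
    intro ε hε t ht
    obtain ⟨U, -, hU⟩ := hu_curve ε hε
    simpa only [← hU t ht] using (U t).continuous
  have hC₀ : 0 ≤ C₀ := (intervalIntegral.integral_nonneg (by linarith [pi_pos])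
    fun x _ => abs_nonneg _).trans (hv₀i (1/2) (by norm_num))
  -- the `L¹` norm of `X` is nonincreasing
  have hXL : ∀ ε ∈ Ioo (0:ℝ) 1, ∀ t ∈ Ici (0:ℝ), (∫ x in (-π)..(-π + 2 * π), |X ε t x|) ≤ C₀ := by
    intro ε hε t ht
    obtain ⟨X', -, hX', hXe⟩ := hX ε hε
    have := intervalIntegral_abs_le_of_discreteTransport (b := -π) (G := 0) (δ := t) hε.1 hT hM₁
      (huc ε hε) (fun t ht x => hu_per ε hε x t ht) (fun t ht x => hu_bdd ε hε x t ht) hX'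
      (hXper ε hε) (fun s hs x => by rw [hXe s hs.1 x, sub_self, abs_zero]) t ⟨ht, le_rfl⟩
    simp only [hX0 ε hε, mul_zero, zero_mul, add_zero] at this
    refine this.trans ?_
    rw [hend]
    exact hv₀i ε hε
  set B := 2 * N * C₀ with hB
  have hB0 : 0 ≤ B := by positivity
  have hh0 : ∀ ε ∈ Ioo (0:ℝ) 1, 0 < ε ^ α := fun ε hε => rpow_pos_of_pos hε.1 _
  have hh1 : ∀ ε ∈ Ioo (0:ℝ) 1, ε ^ α ≤ 1 := fun ε hε =>
    rpow_le_one hε.1.le hε.2.le hα.1.le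
  have hvb : ∀ ε ∈ Ioo (0:ℝ) 1, ∀ t ∈ Ici (0:ℝ), ∀ x, |v ε x t| ≤ (ε ^ α)⁻¹ * (K * B) := by
    intro ε hε t ht x
    have h0 := hh0 ε hε
    have h1 := abs_integral_mul_comp_div_le hT (X ε t).continuous (hXper ε hε t ht) hK hs h0
      (hh1 ε hε) (-π) x
    rw [hv ε hε]
    simp only [mul_left_comm _ (ε ^ α)⁻¹, integral_const_mul]
    rw [abs_mul, abs_of_pos (inv_pos.2 h0)]
    refine mul_le_mul_of_nonneg_left (h1.trans ?_) (inv_pos.2 h0).le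
    rw [hB]
    gcongr
    exact hXL ε hε t ht
  have hdb : ∀ ε ∈ Ioo (0:ℝ) 1, ∀ t ∈ Ici (0:ℝ), ∀ x,
      |deriv (fun z => v ε z t) x| ≤ (ε ^ α)⁻¹ * ((ε ^ α)⁻¹ * (K' * B)) := by
    intro ε hε t ht x
    have h0 := hh0 ε hε
    have h1 := abs_integral_mul_comp_div_le hT (X ε t).continuous (hXper ε hε t ht) hK' hs' h0
      (hh1 ε hε) (-π) x
    simp only [hv ε hε]
    rw [(hasDerivAt_integral_mul_comp_div h0 (X ε t).continuous hφ' hφc x).deriv]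
    simp only [mul_left_comm _ (ε ^ α)⁻¹, integral_const_mul]
    rw [abs_mul, abs_mul, abs_of_pos (inv_pos.2 h0)]
    have h2 := (inv_pos.2 h0).le
    refine mul_le_mul_of_nonneg_left (mul_le_mul_of_nonneg_left (h1.trans ?_) h2) h2
    rw [hB]
    gcongr
    exact hXL ε hε t ht
  intro δ hδ
  set S := n * (K * B) ^ (n - 1) * (K' * B) with hS
  have hS0 : 0 ≤ S := by positivity
  refine ⟨|C₀'| + 2 * π * S * δ + 1, by positivity, fun ε hε t ht => ?_⟩
  obtain ⟨w', -, hw', hwe⟩ := hw ε hε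
  have h0 := hh0 ε hε
  have hsrc : ∀ s ∈ Ico 0 δ, ∀ x, |w' s x - ε⁻¹ * (w ε s (x - ε) * max (u ε (x - ε) s) 0
        - w ε s x * |u ε x s| + w ε s (x + ε) * max (-(u ε (x + ε) s)) 0)|
        ≤ S / (ε ^ α) ^ (n + 1) := by
    intro s hs x
    rw [hwe s hs.1 x, sub_sub_cancel_left, abs_neg, abs_mul, abs_mul, abs_pow, Nat.abs_cast]
    calc (n : ℝ) * |v ε x s| ^ (n - 1) * |deriv (fun z => v ε z s) x|
        ≤ n * ((ε ^ α)⁻¹ * (K * B)) ^ (n - 1) * ((ε ^ α)⁻¹ * ((ε ^ α)⁻¹ * (K' * B))) := by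
          gcongr
          · exact hvb ε hε s hs.1 x
          · exact hdb ε hε s hs.1 x
      _ = S / (ε ^ α) ^ (n + 1) := by
          obtain ⟨m, rfl⟩ := Nat.exists_eq_add_of_le' hn
          rw [hS, Nat.add_sub_cancel, mul_pow, inv_pow]
          field_simp
          ring
  have hfin := intervalIntegral_abs_le_of_discreteTransport (b := -π) hε.1 hT hM₁ (huc ε hε)
    (fun t ht x => hu_per ε hε x t ht) (fun t ht x => hu_bdd ε hε x t ht) hw' (hwper ε hε)
    hsrc t ht
  simp only [hw0 ε hε, hend] at hfin
  have hpow : ε ^ (((n : ℝ) + 1) * α) = (ε ^ α) ^ (n + 1) := by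
    rw [mul_comm, rpow_mul hε.1.le, ← rpow_natCast]
    push_cast
    rfl
  have hp0 : 0 < (ε ^ α) ^ (n + 1) := by positivity
  have hp1 : (ε ^ α) ^ (n + 1) ≤ 1 := pow_le_one₀ h0.le (hh1 ε hε)
  rw [hpow]
  refine hfin.trans ?_
  have ht1 : 2 * π * (S / (ε ^ α) ^ (n + 1)) * t ≤ 2 * π * S * δ / (ε ^ α) ^ (n + 1) := by
    rw [show 2 * π * S * δ / (ε ^ α) ^ (n + 1) = 2 * π * (S / (ε ^ α) ^ (n + 1)) * δ by ring]
    have := ht.2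
    gcongr
  have hw1 : (∫ x in (-π)..π, |w₀ ε x|) ≤ (|C₀'| + 1) / (ε ^ α) ^ (n + 1) := by
    rw [le_div_iff₀ hp0]
    have h2 : (∫ x in (-π)..π, |w₀ ε x|) ≤ |C₀'| + 1 :=
      (hw₀i ε hε).trans (by linarith [le_abs_self C₀'])
    have h3 : 0 ≤ |C₀'| + 1 := by positivity
    nlinarith
  calc _ ≤ (|C₀'| + 1) / (ε ^ α) ^ (n + 1) + 2 * π * S * δ / (ε ^ α) ^ (n + 1) :=
        add_le_add hw1 ht1
    _ = _ := by ring
end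

section
/- (Theorem 1.) Let n ≥ 1 be an integer and suppose 0 < α < 1/(n+1) and 0 < β < α. Assume: (u_ε)_{ε∈(0,1)} continuous, C¹ in x, 2π-periodic in x, bounded by M₁ uniformly in ε, with |∂ₓu_ε(x,t)| ≤ C_δ/ε^β for t ∈ [0,δ]; (v₀ε) continuous 2π-periodic with ∫_{−π}^{π}|v₀ε| ≤ C₀; X_ε the 2π-periodic solution of the discrete transport ODE with velocity u_ε and step ε with X_ε(·,0) = v₀ε; v_ε = X_ε * φ_{ε^α}; (w₀ε) continuous 2π-periodic with ∫_{−π}^{π}|w₀ε| ≤ C₀'; and w_ε a continuously differentiable 2π-periodic curve in C_b(ℝ) with w_ε(·,0) = w₀ε and ∂ₜw_ε(x,t) = (1/ε)[w_ε(x−ε,t)u_ε(x−ε,t)⁺ − w_ε(x,t)|u_ε(x,t)| + w_ε(x+ε,t)u_ε(x+ε,t)⁻] − n·v_ε(x,t)^{n−1}·∂ₓv_ε(x,t). Then for every ψ ∈ C_c^∞(ℝ) and every δ > 0, as ε → 0, ∫₀^δ∫_ℝ (∂ₜv_ε(x,t)ψ(x) − u_ε(x,t)v_ε(x,t)ψ'(x))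 dx dt → 0 and ∫₀^δ∫_ℝ (∂ₜw_ε(x,t)ψ(x) − u_ε(x,t)w_ε(x,t)ψ'(x) − v_ε(x,t)^n ψ'(x)) dx dt → 0; that is, (u_ε, v_ε, w_ε) is a weak asymptotic method for the system ∂ₜu + ∂ₓ(u²) = 0, ∂ₜv + ∂ₓ(uv) = 0, ∂ₜw + ∂ₓ(uw) + ∂ₓ(vⁿ) = 0. -/
open MeasureTheory Set Real Filter

/-- The right-hand side of the discrete transport ODE with velocity `a` and step `ε`. -/
noncomputable def transportOp (ε : ℝ) (a f : ℝ → ℝ) (x : ℝ) : ℝ :=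
  ε⁻¹ * (f (x - ε) * max (a (x - ε)) 0 - f x * |a x| + f (x + ε) * max (-(a (x + ε))) 0)

theorem continuous_transportOp {ε : ℝ} {a f : ℝ → ℝ} (ha : Continuous a) (hf : Continuous f) :
    Continuous (transportOp ε a f) := by
  unfold transportOp
  fun_prop

theorem integral_comp_add_of_periodic {g : ℝ → ℝ} (hg : Function.Periodic g (2 * π)) (s : ℝ) :
    ∫ x in (-π)..π, g (x + s) = ∫ x in (-π)..π, g x := by
  rw [intervalIntegral.integral_comp_add_right]
  have h := hg.intervalIntegral_add_eq (-π + s) (-π)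
  rw [show -π + s + 2 * π = π + s by ring, show -π + 2 * π = π by ring] at h
  exact h

/-- An explicit Euler step of the discrete transport ODE contracts the `L¹` norm. -/
theorem integral_abs_add_transportOp_le {ε M h : ℝ} {a f : ℝ → ℝ} (hε : 0 < ε) (hh : 0 ≤ h)
    (hM : h * M ≤ ε) (ha : Continuous a) (hf : Continuous f)
    (hap : Function.Periodic a (2 * π)) (hfp : Function.Periodic f (2 * π))
    (hb : ∀ x, |a x| ≤ M) :
    ∫ x in (-π)..π, |f x + h * transportOp ε a f x| ≤ ∫ x in (-π)..π, |f x| := by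
  set p : ℝ → ℝ := fun x => |f x| * max (a x) 0 with hp
  set q : ℝ → ℝ := fun x => |f x| * max (-(a x)) 0 with hq
  have hpc : Continuous p := by fun_prop
  have hqc : Continuous q := by fun_prop
  have hpp : Function.Periodic p (2 * π) := fun x => by simp only [hp, hap x, hfp x]
  have hqp : Function.Periodic q (2 * π) := fun x => by simp only [hq, hap x, hfp x]
  have hTc : Continuous (transportOp ε a f) := continuous_transportOp ha hf
  have hpt : ∀ x, |f x + h * transportOp ε a f x| ≤
      (|f x| - h / ε * p x - h / ε * q x) + h / ε * p (x + -ε) + h / ε * q (x + ε) := by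
    intro x
    have hhe : 0 ≤ h / ε := by positivity
    have habs : |a x| = max (a x) 0 + max (-(a x)) 0 := by
      rcases le_total 0 (a x) with h0 | h0
      · rw [abs_of_nonneg h0, max_eq_left h0, max_eq_right (by linarith)]; ring
      · rw [abs_of_nonpos h0, max_eq_right h0, max_eq_left (by linarith)]; ring
    have h1 : 0 ≤ 1 - h / ε * |a x| := by
      have : h / ε * |a x| ≤ 1 := by
        rw [div_mul_eq_mul_div, div_le_one hε]
        exact (mul_le_mul_of_nonneg_left (hb x) hh).trans hM
      linarith
    have e1 : f x + h * transportOp ε a f x = f x * (1 - h / ε * |a x|)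
        + h / ε * (f (x + -ε) * max (a (x + -ε)) 0)
        + h / ε * (f (x + ε) * max (-(a (x + ε))) 0) := by
      unfold transportOp
      rw [← sub_eq_add_neg]
      field_simp
      ring
    rw [e1]
    refine (abs_add_three _ _ _).trans (le_of_eq ?_)
    simp only [hp, hq, abs_mul, abs_of_nonneg h1, abs_of_nonneg hhe]
    rw [abs_of_nonneg (le_max_right (a (x + -ε)) 0),
      abs_of_nonneg (le_max_right (-(a (x + ε))) 0), habs]
    ring
  have hint : ∫ x in (-π)..π, ((|f x| - h / ε * p x - h / ε * q x) + h / ε * p (x + -ε)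
      + h / ε * q (x + ε)) = ∫ x in (-π)..π, |f x| := by
    have i0 : IntervalIntegrable (fun x => |f x|) volume (-π) π :=
      Continuous.intervalIntegrable (by fun_prop) _ _
    have i1 : IntervalIntegrable (fun x => h / ε * p x) volume (-π) π :=
      Continuous.intervalIntegrable (by fun_prop) _ _
    have i2 : IntervalIntegrable (fun x => h / ε * q x) volume (-π) π :=
      Continuous.intervalIntegrable (by fun_prop) _ _
    have i3 : IntervalIntegrable (fun x => h / ε * p (x + -ε)) volume (-π) π :=
      Continuous.intervalIntegrable (by fun_prop) _ _
    have i4 : IntervalIntegrable (fun x => h / ε * q (x + ε)) volume (-π) π :=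
      Continuous.intervalIntegrable (by fun_prop) _ _
    rw [intervalIntegral.integral_add (((i0.sub i1).sub i2).add i3) i4,
      intervalIntegral.integral_add ((i0.sub i1).sub i2) i3,
      intervalIntegral.integral_sub (i0.sub i1) i2, intervalIntegral.integral_sub i0 i1]
    simp only [intervalIntegral.integral_const_mul]
    rw [integral_comp_add_of_periodic hpp, integral_comp_add_of_periodic hqp]
    ring
  rw [← hint]
  refine intervalIntegral.integral_mono_on (by linarith [Real.pi_pos])
    (Continuous.intervalIntegrable (by fun_prop) _ _)
    (Continuous.intervalIntegrable (by fun_prop) _ _) (fun x _ => hpt x)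

theorem integral_abs_add_le {f g : ℝ → ℝ} (hf : Continuous f) (hg : Continuous g) :
    ∫ x in (-π)..π, |f x + g x| ≤ (∫ x in (-π)..π, |f x|) + ∫ x in (-π)..π, |g x| := by
  rw [← intervalIntegral.integral_add (Continuous.intervalIntegrable (by fun_prop) _ _)
    (Continuous.intervalIntegrable (by fun_prop) _ _)]
  exact intervalIntegral.integral_mono_on (by linarith [Real.pi_pos])
    (Continuous.intervalIntegrable (by fun_prop) _ _)
    (Continuous.intervalIntegrable (by fun_prop) _ _) (fun x _ => abs_add_le _ _)

theorem integral_abs_le_of_abs_le {f : ℝ → ℝ} {C : ℝ} (hf : Continuous f) (h : ∀ x, |f x| ≤ C) :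
    ∫ x in (-π)..π, |f x| ≤ 2 * π * C := by
  calc ∫ x in (-π)..π, |f x| ≤ ∫ x in (-π)..π, C :=
        intervalIntegral.integral_mono_on (by linarith [Real.pi_pos])
          (Continuous.intervalIntegrable (by fun_prop) _ _)
          (Continuous.intervalIntegrable (by fun_prop) _ _) (fun x _ => h x)
    _ = 2 * π * C := by rw [intervalIntegral.integral_const, smul_eq_mul]; ring

/-- `L¹` bound for solutions of the discrete transport ODE with a source term bounded by `G`. -/
theorem integral_abs_le_of_transport {ε M G δ : ℝ} (hε : 0 < ε) (hM0 : 0 < M)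
    {u g : ℝ → ℝ → ℝ} {W W' : ℝ → BoundedContinuousFunction ℝ ℝ}
    (hu : ∀ t ∈ Ici (0 : ℝ), Continuous (u t))
    (hup : ∀ t ∈ Ici (0 : ℝ), Function.Periodic (u t) (2 * π))
    (hub : ∀ t ∈ Ici (0 : ℝ), ∀ x, |u t x| ≤ M)
    (hWp : ∀ t ∈ Ici (0 : ℝ), Function.Periodic (W t) (2 * π))
    (hW : ∀ t ∈ Ici (0 : ℝ), HasDerivWithinAt W (W' t) (Ici 0) t)
    (hW' : ∀ t ∈ Ici (0 : ℝ), ∀ x, W' t x = transportOp ε (u t) (W t) x - g t x)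
    (hg : ∀ t ∈ Icc 0 δ, ∀ x, |g t x| ≤ G) {t : ℝ} (ht : t ∈ Icc 0 δ) :
    ∫ x in (-π)..π, |W t x| ≤ (∫ x in (-π)..π, |W 0 x|) + 2 * π * G * t := by
  have hpi := Real.pi_pos
  set N : BoundedContinuousFunction ℝ ℝ → ℝ := fun f => ∫ x in (-π)..π, |f x| with hN
  have hNle : ∀ f, N f ≤ 2 * π * ‖f‖ := fun f =>
    integral_abs_le_of_abs_le f.continuous fun x => f.norm_coe_le_norm x
  have hNadd : ∀ f g, N (f + g) ≤ N f + N g := fun f g =>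
    integral_abs_add_le f.continuous g.continuous
  have hNlip : LipschitzWith (Real.toNNReal (2 * π)) N := by
    refine LipschitzWith.of_le_add_mul _ fun f g => ?_
    have h1 := hNadd g (f - g)
    have h2 := hNle (f - g)
    rw [add_sub_cancel] at h1
    rw [dist_eq_norm, Real.coe_toNNReal _ (by positivity)]
    linarith
  refine image_le_of_liminf_slope_right_le_deriv_boundary (f := fun t => N (W t))
    (B := fun t => N (W 0) + 2 * π * G * t) (B' := fun _ => 2 * π * G) (a := 0) (b := δ)
    ?_ (by simp) (by fun_prop) ?_ ?_ ht
  · refine hNlip.continuous.comp_continuousOn fun s hs => ?_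
    exact (hW s hs.1).continuousWithinAt.mono Icc_subset_Ici_self
  · intro s _
    simpa using (((hasDerivAt_id s).const_mul (2 * π * G)).const_add (N (W 0))).hasDerivWithinAt
  · intro s hs r hr
    have hs0 : s ∈ Ici (0 : ℝ) := hs.1
    apply Eventually.frequently
    have hd := (hW s hs0).mono (Ioi_subset_Ici hs.1)
    rw [hasDerivWithinAt_iff_isLittleO] at hd
    have hc : 0 < (r - 2 * π * G) / (4 * π) := by
      apply div_pos <;> linarith
    have hd1 := hd.def hc
    have hd2 : ∀ᶠ z in nhdsWithin s (Ioi s), z < s + ε / M :=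
      mem_nhdsWithin_of_mem_nhds (Iio_mem_nhds (by have := div_pos hε hM0; linarith))
    filter_upwards [hd1, hd2, self_mem_nhdsWithin] with z hz1 hz2 hz3
    have hz3' : 0 < z - s := sub_pos.2 hz3
    set h := z - s with hh
    have hhM : h * M ≤ ε := by
      have : h < ε / M := by rw [hh]; linarith
      rw [lt_div_iff₀ hM0] at this
      exact this.le
    have k1 : N (W s + h • W' s) ≤ N (W s) + h * (2 * π * G) := by
      have hgc : Continuous (g s) := by
        have : g s = fun x => transportOp ε (u s) (W s) x - W' s x := by
          funext x; rw [hW' s hs0 x]; ring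
        rw [this]
        exact (continuous_transportOp (hu s hs0) (W s).continuous).sub (W' s).continuous
      have hTc := continuous_transportOp (ε := ε) (hu s hs0) (W s).continuous
      have e : N (W s + h • W' s) = ∫ x in (-π)..π,
          |(W s x + h * transportOp ε (u s) (W s) x) + (-(h * g s x))| := by
        simp only [hN]
        congr 1
        funext x
        simp only [BoundedContinuousFunction.coe_add, Pi.add_apply,
          BoundedContinuousFunction.coe_smul, smul_eq_mul, hW' s hs0 x]
        congr 1; ring
      rw [e]
      refine (integral_abs_add_le ((W s).continuous.add (by fun_prop)) (by fun_prop)).trans ?_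
      refine add_le_add (integral_abs_add_transportOp_le hε hz3'.le hhM (hu s hs0)
        (W s).continuous (hup s hs0) (hWp s hs0) (hub s hs0)) ?_
      refine (integral_abs_le_of_abs_le (C := h * G) (by fun_prop) fun x => ?_).trans
        (le_of_eq (by ring))
      rw [abs_neg, abs_mul, abs_of_pos hz3']
      exact mul_le_mul_of_nonneg_left (hg s (Ico_subset_Icc_self hs) x) hz3'.le
    have k2 : N (W z) ≤ N (W s + h • W' s) + 2 * π * ‖W z - W s - h • W' s‖ := by
      have h1 := hNadd (W s + h • W' s) (W z - W s - h • W' s)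
      have h2 := hNle (W z - W s - h • W' s)
      rw [show W s + h • W' s + (W z - W s - h • W' s) = W z by abel] at h1
      linarith
    rw [Real.norm_eq_abs, abs_of_pos hz3'] at hz1
    have k3 : 2 * π * ‖W z - W s - h • W' s‖ ≤ h * ((r - 2 * π * G) / 2) := by
      calc _ ≤ 2 * π * ((r - 2 * π * G) / (4 * π) * h) := by gcongr
        _ = _ := by field_simp; ring
    have k4 : slope (fun t => N (W t)) s z = (N (W z) - N (W s)) / h := by
      rw [slope_def_field]
    rw [k4, div_lt_iff₀ hz3']
    nlinarith

/-- Testing a periodic function against a function with support in `(-mπ, mπ)`. -/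
theorem abs_integral_mul_le_of_periodic {f g : ℝ → ℝ} {K : ℝ} {m : ℕ} (hf : Continuous f)
    (hfp : Function.Periodic f (2 * π)) (hg : ∀ x, |g x| ≤ K)
    (hg0 : ∀ x, m * π ≤ |x| → g x = 0) :
    |∫ x, f x * g x| ≤ K * (m * ∫ x in (-π)..π, |f x|) := by
  have hper : Function.Periodic (fun x => |f x|) (2 * π) := fun x => by simp only [hfp x]
  have hI : ∫ x in (-(m * π))..(m * π), |f x| = m * ∫ x in (-π)..π, |f x| := by
    have h := hper.intervalIntegral_add_zsmul_eq m (-(m * π)) fun _ _ =>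
      Continuous.intervalIntegrable (by fun_prop) _ _
    rw [hper.intervalIntegral_add_eq _ (-π)] at h
    simp only [zsmul_eq_mul, Int.cast_natCast] at h
    rw [show -(m * π) + m * (2 * π) = m * π by ring, show -π + 2 * π = π by ring] at h
    exact h
  have hmp : 0 ≤ m * π := by positivity
  have hle : -(m * π) ≤ m * π := by linarith
  rw [← hI, intervalIntegral.integral_of_le hle, ← integral_const_mul,
    ← integral_indicator measurableSet_Ioc]
  have hint : IntegrableOn (fun x => K * |f x|) (Ioc (-(m * π)) (m * π)) :=
    Continuous.integrableOn_Ioc (by fun_prop)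
  change ‖∫ x, f x * g x‖ ≤ _
  refine norm_integral_le_of_norm_le (hint.integrable_indicator measurableSet_Ioc)
    (Eventually.of_forall fun x => ?_)
  have hK : 0 ≤ K := (abs_nonneg _).trans (hg 0)
  by_cases hx : m * π ≤ |x|
  · rw [hg0 x hx, mul_zero, norm_zero]
    exact indicator_nonneg (fun y _ => by positivity) x
  · have hx' := abs_lt.1 (not_le.1 hx)
    rw [indicator_of_mem (show x ∈ Ioc (-(m * π)) (m * π) from ⟨hx'.1, hx'.2.le⟩), norm_mul,
      mul_comm]
    exact mul_le_mul_of_nonneg_right (hg x) (abs_nonneg _)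

theorem hasCompactSupport_of_vanish {R : ℝ} {ψ : ℝ → ℝ} (hR : ∀ x, R ≤ |x| → ψ x = 0) :
    HasCompactSupport ψ := by
  refine HasCompactSupport.intro (isCompact_Icc (a := -R) (b := R)) fun x hx => hR x ?_
  by_contra! h
  exact hx ⟨(abs_lt.1 h).1.le, (abs_lt.1 h).2.le⟩

theorem integrable_mul_of_hasCompactSupport {g ψ : ℝ → ℝ} (hg : Continuous g) (hψ : Continuous ψ)
    (hψc : HasCompactSupport ψ) : Integrable fun x => g x * ψ x :=
  (hg.mul hψ).integrable_of_hasCompactSupport hψc.mul_left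

theorem abs_sub_sub_mul_le {ψ ψ' : ℝ → ℝ} {K : ℝ} (hψ : ∀ x, HasDerivAt ψ (ψ' x) x)
    (hK : ∀ x y, |ψ' x - ψ' y| ≤ K * |x - y|) (x s : ℝ) :
    |ψ (x + s) - ψ x - s * ψ' x| ≤ K * s ^ 2 := by
  have hK0 : 0 ≤ K := by simpa using (abs_nonneg _).trans (hK 1 0)
  have hd : ∀ z, HasDerivAt (fun z => ψ (x + z) - z * ψ' x) (ψ' (x + z) - ψ' x) z := fun z => by
    have h1 : HasDerivAt (fun z => ψ (x + z)) (ψ' (x + z)) z := by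
      simpa using (hψ (x + z)).comp_const_add x z
    simpa using h1.fun_sub ((hasDerivAt_id z).mul_const (ψ' x))
  have h := (convex_closedBall (0 : ℝ) |s|).norm_image_sub_le_of_norm_deriv_le
    (f := fun z => ψ (x + z) - z * ψ' x) (C := K * |s|) (x := 0) (y := s)
    (fun z _ => (hd z).differentiableAt) (fun z hz => ?_) (by simp) (by simp)
  · have e : ψ (x + s) - ψ x - s * ψ' x
        = ψ (x + s) - s * ψ' x - (ψ (x + 0) - 0 * ψ' x) := by rw [add_zero]; ring
    rw [e]
    refine h.trans (le_of_eq ?_)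
    rw [sub_zero, Real.norm_eq_abs, mul_assoc, ← sq, sq_abs]
  · rw [(hd z).deriv, Real.norm_eq_abs]
    refine (hK _ _).trans ?_
    rw [add_sub_cancel_left]
    exact mul_le_mul_of_nonneg_left (by simpa using hz) hK0

/-- Consistency of the discrete transport operator in the weak sense. -/
theorem abs_integral_transportOp_mul_sub_le {ε M K R : ℝ} {m : ℕ} {a f ψ ψ' : ℝ → ℝ}
    (hε : 0 < ε) (hε1 : ε ≤ 1) (ha : Continuous a) (hf : Continuous f)
    (hfp : Function.Periodic f (2 * π)) (hb : ∀ x, |a x| ≤ M)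
    (hψ : ∀ x, HasDerivAt ψ (ψ' x) x) (hψ'c : Continuous ψ')
    (hK : ∀ x y, |ψ' x - ψ' y| ≤ K * |x - y|)
    (hR : ∀ x, R ≤ |x| → ψ x = 0) (hR' : ∀ x, R ≤ |x| → ψ' x = 0) (hm : R + 1 ≤ m * π) :
    |(∫ x, transportOp ε a f x * ψ x) - ∫ x, f x * a x * ψ' x| ≤
      ε * M * K * (m * ∫ x in (-π)..π, |f x|) := by
  have hK0 : 0 ≤ K := by simpa using (abs_nonneg _).trans (hK 1 0)
  have hψc : Continuous ψ := continuous_iff_continuousAt.2 fun x => (hψ x).continuousAt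
  have hR0 : ∀ s, |s| ≤ 1 → ∀ x, m * π ≤ |x| → ψ (x + s) = 0 := fun s hs x hx => by
    refine hR _ ?_
    have := abs_sub_abs_le_abs_sub x (-s)
    rw [abs_neg, sub_neg_eq_add] at this
    linarith
  set D : ℝ → ℝ := fun x => ε⁻¹ * (max (a x) 0 * (ψ (x + ε) - ψ x)
    + max (-(a x)) 0 * (ψ (x - ε) - ψ x)) - a x * ψ' x with hD
  have habs : ∀ x, |a x| = max (a x) 0 + max (-(a x)) 0 := fun x => by
    rcases le_total 0 (a x) with h0 | h0
    · rw [abs_of_nonneg h0, max_eq_left h0, max_eq_right (by linarith)]; ring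
    · rw [abs_of_nonpos h0, max_eq_right h0, max_eq_left (by linarith)]; ring
  have hpm : ∀ x, a x = max (a x) 0 - max (-(a x)) 0 := fun x => by
    rcases le_total 0 (a x) with h0 | h0
    · rw [max_eq_left h0, max_eq_right (by linarith)]; ring
    · rw [max_eq_right h0, max_eq_left (by linarith)]; ring
  have heq : (∫ x, transportOp ε a f x * ψ x) - ∫ x, f x * a x * ψ' x = ∫ x, f x * D x := by
    have cs : ∀ s, |s| ≤ 1 → HasCompactSupport fun x => ψ (x + s) := fun s hs =>
      hasCompactSupport_of_vanish (hR0 s hs)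
    have c0 := hasCompactSupport_of_vanish hR
    have c0' := hasCompactSupport_of_vanish hR'
    have e1 : ∫ x, f (x - ε) * max (a (x - ε)) 0 * ψ x
        = ∫ x, f x * max (a x) 0 * ψ (x + ε) := by
      have := integral_sub_right_eq_self (μ := volume)
        (fun x => f x * max (a x) 0 * ψ (x + ε)) ε
      simpa using this
    have e2 : ∫ x, f (x + ε) * max (-(a (x + ε))) 0 * ψ x
        = ∫ x, f x * max (-(a x)) 0 * ψ (x + -ε) := by
      have := integral_add_right_eq_self (μ := volume)
        (fun x => f x * max (-(a x)) 0 * ψ (x + -ε)) ε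
      simpa using this
    have i1 : Integrable fun x => f (x - ε) * max (a (x - ε)) 0 * ψ x :=
      integrable_mul_of_hasCompactSupport (by fun_prop) hψc c0
    have i2 : Integrable fun x => f x * |a x| * ψ x :=
      integrable_mul_of_hasCompactSupport (by fun_prop) hψc c0
    have i3 : Integrable fun x => f (x + ε) * max (-(a (x + ε))) 0 * ψ x :=
      integrable_mul_of_hasCompactSupport (by fun_prop) hψc c0
    have j1 : Integrable fun x => f x * max (a x) 0 * ψ (x + ε) :=
      integrable_mul_of_hasCompactSupport (by fun_prop) (by fun_prop)
        (cs ε (by rwa [abs_of_pos hε]))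
    have j3 : Integrable fun x => f x * max (-(a x)) 0 * ψ (x + -ε) :=
      integrable_mul_of_hasCompactSupport (by fun_prop) (by fun_prop)
        (cs (-ε) (by rwa [abs_neg, abs_of_pos hε]))
    have j4 : Integrable fun x => f x * a x * ψ' x :=
      integrable_mul_of_hasCompactSupport (by fun_prop) hψ'c c0'
    have i12 : Integrable fun x => f (x - ε) * max (a (x - ε)) 0 * ψ x - f x * |a x| * ψ x :=
      i1.sub i2
    have j12 : Integrable fun x => f x * max (a x) 0 * ψ (x + ε) - f x * |a x| * ψ x :=
      j1.sub i2
    have j123 : Integrable fun x => f x * max (a x) 0 * ψ (x + ε) - f x * |a x| * ψ x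
      + f x * max (-(a x)) 0 * ψ (x + -ε) := j12.add j3
    have t1 : ∫ x, transportOp ε a f x * ψ x = ε⁻¹ * ((∫ x, f x * max (a x) 0 * ψ (x + ε))
        - (∫ x, f x * |a x| * ψ x) + ∫ x, f x * max (-(a x)) 0 * ψ (x + -ε)) := by
      rw [← e1, ← e2, ← integral_sub i1 i2, ← integral_add i12 i3, ← integral_const_mul]
      refine integral_congr_ae (Eventually.of_forall fun x => ?_)
      simp only [transportOp]
      ring
    rw [t1, ← integral_sub j1 i2, ← integral_add j12 j3, ← integral_const_mul,
      ← integral_sub (j123.const_mul _) j4]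
    refine integral_congr_ae (Eventually.of_forall fun x => ?_)
    simp only [hD, habs x, sub_eq_add_neg]
    ring
  rw [heq]
  refine abs_integral_mul_le_of_periodic hf hfp (fun x => ?_) (fun x hx => ?_)
  · have h1 := abs_sub_sub_mul_le hψ hK x ε
    have h2 := abs_sub_sub_mul_le hψ hK x (-ε)
    have e : D x = ε⁻¹ * (max (a x) 0 * (ψ (x + ε) - ψ x - ε * ψ' x)
        + max (-(a x)) 0 * (ψ (x + -ε) - ψ x - -ε * ψ' x)) := by
      have := hpm x
      simp only [hD, ← sub_eq_add_neg]
      field_simp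
      linear_combination (-(ε * ψ' x)) * this
    rw [e, abs_mul, abs_of_pos (inv_pos.2 hε)]
    have h3 : |max (a x) 0 * (ψ (x + ε) - ψ x - ε * ψ' x)
        + max (-(a x)) 0 * (ψ (x + -ε) - ψ x - -ε * ψ' x)| ≤ M * (K * ε ^ 2) := by
      refine (abs_add_le _ _).trans ?_
      rw [abs_mul, abs_mul, abs_of_nonneg (le_max_right (a x) 0),
        abs_of_nonneg (le_max_right (-(a x)) 0)]
      rw [neg_sq] at h2
      calc _ ≤ max (a x) 0 * (K * ε ^ 2) + max (-(a x)) 0 * (K * ε ^ 2) := by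
            gcongr
        _ = |a x| * (K * ε ^ 2) := by rw [habs x]; ring
        _ ≤ _ := by gcongr; exact hb x
    calc _ ≤ ε⁻¹ * (M * (K * ε ^ 2)) := by gcongr
      _ = _ := by field_simp
  · have h1 := hR0 ε (by rwa [abs_of_pos hε]) x hx
    have h2 := hR0 (-ε) (by rwa [abs_neg, abs_of_pos hε]) x hx
    have h3 : ψ x = 0 := hR x (by linarith)
    have h4 : ψ' x = 0 := hR' x (by linarith)
    rw [← sub_eq_add_neg] at h2
    simp only [hD, h1, h2, h3, h4]
    ring

/-- Testing a mollified function amounts to averaging translates of the test function. -/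
theorem integral_mollify_mul {F k G : ℝ → ℝ} (hF : Continuous F) (hk : Continuous k)
    (hkc : HasCompactSupport k) (hG : Continuous G) (hGc : HasCompactSupport G) :
    ∫ x, (∫ y, F (x - y) * k y) * G x = ∫ y, k y * ∫ x, F x * G (x + y) := by
  have hswap := integral_integral_swap_of_hasCompactSupport (μ := volume) (ν := volume)
    (f := fun x y => F (x - y) * k y * G x) (by simp only [Function.uncurry_def]; fun_prop)
    (HasCompactSupport.intro (hGc.isCompact.prod hkc.isCompact) (by
      rintro ⟨x, y⟩ hxy
      simp only [mem_prod, not_and_or] at hxy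
      rcases hxy with h | h
      · simp [image_eq_zero_of_notMem_tsupport h]
      · simp [image_eq_zero_of_notMem_tsupport h]))
  simp only [integral_mul_const] at hswap
  rw [hswap]
  refine integral_congr_ae (Eventually.of_forall fun y => ?_)
  have h := integral_sub_right_eq_self (μ := volume) (fun x => F x * G (x + y)) y
  simp only [sub_add_cancel] at h
  simp only [← h, ← integral_const_mul]
  refine integral_congr_ae (Eventually.of_forall fun x => ?_)
  simp only
  ring

theorem continuous_mollify {F k : ℝ → ℝ} (hF : Continuous F) (hk : Continuous k)
    (hkc : HasCompactSupport k) : Continuous fun x => ∫ y, F (x - y) * k y := by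
  have h := hkc.continuous_convolution_left (ContinuousLinearMap.mul ℝ ℝ) (μ := volume) hk
    hF.locallyIntegrable
  refine h.congr fun x => ?_
  simp only [convolution_def, ContinuousLinearMap.mul_apply', mul_comm]

theorem hasDerivAt_mollify {F k : ℝ → ℝ} (hF : Continuous F) (hk : ContDiff ℝ 1 k)
    (hkc : HasCompactSupport k) (x : ℝ) :
    HasDerivAt (fun x => ∫ y, F (x - y) * k y) (∫ y, F (x - y) * deriv k y) x := by
  have h := hkc.hasDerivAt_convolution_left (ContinuousLinearMap.mul ℝ ℝ) (μ := volume) hk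
    hF.locallyIntegrable x
  have e : ∀ k : ℝ → ℝ, (convolution k F (ContinuousLinearMap.mul ℝ ℝ) volume)
      = fun x => ∫ y, F (x - y) * k y := fun k => by
    funext x
    simp only [convolution_def, ContinuousLinearMap.mul_apply', mul_comm]
  rw [e, e] at h
  exact h

theorem abs_mollify_le {F k : ℝ → ℝ} {K : ℝ} {m : ℕ} (hF : Continuous F)
    (hFp : Function.Periodic F (2 * π)) (hk : ∀ x, |k x| ≤ K) (hk0 : ∀ x, m * π ≤ |x| → k x = 0)
    (x : ℝ) : |∫ y, F (x - y) * k y| ≤ K * (m * ∫ x in (-π)..π, |F x|) := by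
  have hper : Function.Periodic (fun y => F (x - y)) (2 * π) := fun y => by
    have := hFp.sub_eq (x - y)
    rwa [sub_sub] at this
  have h := abs_integral_mul_le_of_periodic (f := fun y => F (x - y)) (by fun_prop) hper hk hk0
  have hI : ∫ y in (-π)..π, |F (x - y)| = ∫ y in (-π)..π, |F y| := by
    rw [intervalIntegral.integral_comp_sub_left (fun y => |F y|) x,
      show x - -π = (x - π) + 2 * π by ring]
    have hp : Function.Periodic (fun y => |F y|) (2 * π) := fun y => by simp only [hFp y]
    rw [hp.intervalIntegral_add_eq _ (-π), show -π + 2 * π = π by ring]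
  rwa [hI] at h

theorem continuous_integral_mul_translate {F G : ℝ → ℝ} (hF : Continuous F) (hG : Continuous G)
    (hGc : HasCompactSupport G) : Continuous fun y => ∫ x, F x * G (x + y) := by
  refine (continuous_mollify (F := fun z => F (-z)) (by fun_prop) hG hGc).congr fun y => ?_
  have h := integral_sub_right_eq_self (μ := volume) (fun x => F x * G (x + y)) y
  simpa [neg_sub] using h

/-- Weak residual of the mollified discrete transport equation. -/
theorem abs_integral_mollify_transportOp_le {ε M K L S R ρ : ℝ} {m : ℕ} {a f k ψ ψ' : ℝ → ℝ}
    (hε : 0 < ε) (hε1 : ε ≤ 1) (ha : Continuous a) (hf : Continuous f)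
    (hfp : Function.Periodic f (2 * π)) (hb : ∀ x, |a x| ≤ M)
    (haL : ∀ x y, |a x - a y| ≤ L * |x - y|) (hk : Continuous k)
    (hkρ : ∀ y, ρ ≤ |y| → k y = 0)
    (hψ : ∀ x, HasDerivAt ψ (ψ' x) x) (hψ'c : Continuous ψ')
    (hK : ∀ x y, |ψ' x - ψ' y| ≤ K * |x - y|) (hS : ∀ x, |ψ' x| ≤ S)
    (hR : ∀ x, R ≤ |x| → ψ x = 0) (hR' : ∀ x, R ≤ |x| → ψ' x = 0) (hm : R + ρ + 1 ≤ m * π) :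
    |∫ x, ((∫ y, transportOp ε a f (x - y) * k y) * ψ x
        - a x * (∫ y, f (x - y) * k y) * ψ' x)| ≤
      (∫ y, |k y|) * ((ε * M * K + L * ρ * S) * (m * ∫ x in (-π)..π, |f x|)) := by
  have hL0 : 0 ≤ L := by simpa using (abs_nonneg _).trans (haL 1 0)
  have hS0 : 0 ≤ S := (abs_nonneg _).trans (hS 0)
  have hψc : Continuous ψ := continuous_iff_continuousAt.2 fun x => (hψ x).continuousAt
  have hkc := hasCompactSupport_of_vanish hkρ
  have hψs := hasCompactSupport_of_vanish hR
  have hψs' := hasCompactSupport_of_vanish hR'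
  have hTc : Continuous (transportOp ε a f) := continuous_transportOp ha hf
  have i1 : Integrable fun x => (∫ y, transportOp ε a f (x - y) * k y) * ψ x :=
    integrable_mul_of_hasCompactSupport (continuous_mollify hTc hk hkc) hψc hψs
  have i2 : Integrable fun x => (∫ y, f (x - y) * k y) * (a x * ψ' x) :=
    integrable_mul_of_hasCompactSupport (continuous_mollify hf hk hkc) (by fun_prop) hψs'.mul_left
  have e0 : ∫ x, ((∫ y, transportOp ε a f (x - y) * k y) * ψ x
        - a x * (∫ y, f (x - y) * k y) * ψ' x) =
      (∫ y, k y * ∫ x, transportOp ε a f x * ψ (x + y))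
        - ∫ y, k y * ∫ x, f x * (a (x + y) * ψ' (x + y)) := by
    rw [← integral_mollify_mul hTc hk hkc hψc hψs,
      ← integral_mollify_mul hf hk hkc (G := fun x => a x * ψ' x) (by fun_prop) hψs'.mul_left,
      ← integral_sub i1 i2]
    refine integral_congr_ae (Eventually.of_forall fun x => ?_)
    simp only
    ring
  have j1 : Integrable fun y => k y * ∫ x, transportOp ε a f x * ψ (x + y) := by
    simpa only [mul_comm] using integrable_mul_of_hasCompactSupport
      (continuous_integral_mul_translate hTc hψc hψs) hk hkc
  have j2 : Integrable fun y => k y * ∫ x, f x * (a (x + y) * ψ' (x + y)) := by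
    have := integrable_mul_of_hasCompactSupport
      (continuous_integral_mul_translate (G := fun x => a x * ψ' x) hf (by fun_prop)
        hψs'.mul_left) hk hkc
    exact this.congr (Eventually.of_forall fun y => mul_comm _ _)
  rw [e0, ← integral_sub j1 j2, ← integral_mul_const]
  rw [← Real.norm_eq_abs]
  refine norm_integral_le_of_norm_le
    ((hk.abs.integrable_of_hasCompactSupport hkc.abs).mul_const _)
    (Eventually.of_forall fun y => ?_)
  rw [← mul_sub, norm_mul]
  rcases le_or_gt ρ |y| with hy | hy
  · simp [hkρ y hy]
  refine mul_le_mul_of_nonneg_left ?_ (abs_nonneg _)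
  have hshift : ∀ x, R + ρ ≤ |x| → R ≤ |x + y| := fun x hx => by
    have := abs_sub_abs_le_abs_sub x (-y)
    rw [abs_neg, sub_neg_eq_add] at this
    linarith
  have c1 := abs_integral_transportOp_mul_sub_le (ψ := fun x => ψ (x + y))
    (ψ' := fun x => ψ' (x + y)) hε hε1 ha hf hfp hb (fun x => (hψ (x + y)).comp_add_const x y)
    (by fun_prop) (fun x z => by simpa using hK (x + y) (z + y))
    (fun x hx => hR _ (hshift x hx)) (fun x hx => hR' _ (hshift x hx)) hm
  have c2 := abs_integral_mul_le_of_periodic (K := L * ρ * S) (m := m)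
    (g := fun x => (a x - a (x + y)) * ψ' (x + y)) hf hfp
    (fun x => by
      rw [abs_mul]
      have h1 := haL x (x + y)
      rw [sub_add_cancel_left, abs_neg] at h1
      exact mul_le_mul (h1.trans (mul_le_mul_of_nonneg_left hy.le hL0)) (hS _) (abs_nonneg _)
        (mul_nonneg hL0 ((abs_nonneg y).trans hy.le)))
    (fun x hx => by rw [hR' _ (hshift x (by linarith)), mul_zero])
  have hs' : HasCompactSupport fun x => ψ' (x + y) :=
    hasCompactSupport_of_vanish fun x hx => hR' _ (hshift x hx)
  have l1 : Integrable fun x => f x * a x * ψ' (x + y) :=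
    integrable_mul_of_hasCompactSupport (by fun_prop) (by fun_prop) hs'
  have l2 : Integrable fun x => f x * (a (x + y) * ψ' (x + y)) := by
    simpa only [mul_assoc] using integrable_mul_of_hasCompactSupport
      (g := fun x => f x * a (x + y)) (by fun_prop) (by fun_prop) hs'
  have e1 : ∫ x, f x * ((a x - a (x + y)) * ψ' (x + y))
      = (∫ x, f x * a x * ψ' (x + y)) - ∫ x, f x * (a (x + y) * ψ' (x + y)) := by
    rw [← integral_sub l1 l2]
    refine integral_congr_ae (Eventually.of_forall fun x => ?_)
    simp only
    ring
  rw [e1] at c2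
  rw [Real.norm_eq_abs]
  refine (abs_sub_le _ (∫ x, f x * a x * ψ' (x + y)) _).trans ?_
  linarith

/-- Weak residual of the discrete transport equation with a source in divergence form. -/
theorem abs_integral_transportOp_source_le {ε M K R : ℝ} {m : ℕ} {a f q q' ψ ψ' : ℝ → ℝ}
    (hε : 0 < ε) (hε1 : ε ≤ 1) (ha : Continuous a) (hf : Continuous f)
    (hfp : Function.Periodic f (2 * π)) (hb : ∀ x, |a x| ≤ M)
    (hq : ∀ x, HasDerivAt q (q' x) x) (hq'c : Continuous q')
    (hψ : ∀ x, HasDerivAt ψ (ψ' x) x) (hψ'c : Continuous ψ')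
    (hK : ∀ x y, |ψ' x - ψ' y| ≤ K * |x - y|)
    (hR : ∀ x, R ≤ |x| → ψ x = 0) (hR' : ∀ x, R ≤ |x| → ψ' x = 0) (hm : R + 1 ≤ m * π) :
    |∫ x, ((transportOp ε a f x - q' x) * ψ x - a x * f x * ψ' x - q x * ψ' x)| ≤
      ε * M * K * (m * ∫ x in (-π)..π, |f x|) := by
  have hψc : Continuous ψ := continuous_iff_continuousAt.2 fun x => (hψ x).continuousAt
  have hqc : Continuous q := continuous_iff_continuousAt.2 fun x => (hq x).continuousAt
  have c0 := hasCompactSupport_of_vanish hR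
  have c0' := hasCompactSupport_of_vanish hR'
  have i1 : Integrable fun x => transportOp ε a f x * ψ x :=
    integrable_mul_of_hasCompactSupport (continuous_transportOp ha hf) hψc c0
  have i2 : Integrable fun x => f x * a x * ψ' x :=
    integrable_mul_of_hasCompactSupport (by fun_prop) hψ'c c0'
  have i12 : Integrable fun x => transportOp ε a f x * ψ x - f x * a x * ψ' x := i1.sub i2
  have i3 : Integrable fun x => q' x * ψ x + q x * ψ' x :=
    (integrable_mul_of_hasCompactSupport hq'c hψc c0).add
      (integrable_mul_of_hasCompactSupport hqc hψ'c c0')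
  have h0 : ∫ x, (q' x * ψ x + q x * ψ' x) = 0 :=
    integral_eq_zero_of_hasDerivAt_of_integrable (fun x => (hq x).mul (hψ x)) i3
      (integrable_mul_of_hasCompactSupport hqc hψc c0)
  have e : ∫ x, ((transportOp ε a f x - q' x) * ψ x - a x * f x * ψ' x - q x * ψ' x)
      = (∫ x, transportOp ε a f x * ψ x) - ∫ x, f x * a x * ψ' x := by
    rw [← sub_zero ((∫ x, transportOp ε a f x * ψ x) - _), ← h0, ← integral_sub i1 i2,
      ← integral_sub i12 i3]
    refine integral_congr_ae (Eventually.of_forall fun x => ?_)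
    simp only
    ring
  rw [e]
  exact abs_integral_transportOp_mul_sub_le hε hε1 ha hf hfp hb hψ hψ'c hK hR hR' hm

theorem hasDerivWithinAt_integral_mul {Y : ℝ → BoundedContinuousFunction ℝ ℝ}
    {Y' : BoundedContinuousFunction ℝ ℝ} {s : Set ℝ} {t : ℝ} {k : ℝ → ℝ}
    (hY : HasDerivWithinAt Y Y' s t) (hk : Continuous k) (hkc : HasCompactSupport k) (x : ℝ) :
    HasDerivWithinAt (fun r => ∫ y, Y r (x - y) * k y) (∫ y, Y' (x - y) * k y) s t := by
  have hi : ∀ f : BoundedContinuousFunction ℝ ℝ, Integrable fun y => f (x - y) * k y := fun f =>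
    integrable_mul_of_hasCompactSupport (by fun_prop) hk hkc
  let L : BoundedContinuousFunction ℝ ℝ →L[ℝ] ℝ := LinearMap.mkContinuous
    { toFun := fun f => ∫ y, f (x - y) * k y
      map_add' := fun f g => by
        rw [← integral_add (hi f) (hi g)]
        refine integral_congr_ae (Eventually.of_forall fun y => ?_)
        simp only [BoundedContinuousFunction.coe_add, Pi.add_apply]
        ring
      map_smul' := fun c f => by
        rw [RingHom.id_apply, smul_eq_mul, ← integral_const_mul]
        refine integral_congr_ae (Eventually.of_forall fun y => ?_)
        simp only [BoundedContinuousFunction.coe_smul, smul_eq_mul]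
        ring }
    (∫ y, |k y|) (fun f => by
      rw [← integral_mul_const]
      refine norm_integral_le_of_norm_le
        ((hk.abs.integrable_of_hasCompactSupport hkc.abs).mul_const _)
        (Eventually.of_forall fun y => ?_)
      rw [norm_mul, mul_comm]
      exact mul_le_mul_of_nonneg_left (f.norm_coe_le_norm _) (abs_nonneg _))
  exact L.hasFDerivAt.comp_hasDerivWithinAt t hY

/-- Uniform bounds for a test function. -/
theorem exists_test_function_bounds {ψ : ℝ → ℝ} (hψ : ContDiff ℝ (⊤ : ℕ∞) ψ)
    (hψc : HasCompactSupport ψ) : ∃ R S₀ S K : ℝ, 0 < R ∧ (∀ x, R ≤ |x| → ψ x = 0) ∧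
      (∀ x, R ≤ |x| → deriv ψ x = 0) ∧ (∀ x, |ψ x| ≤ S₀) ∧ (∀ x, |deriv ψ x| ≤ S) ∧
      ∀ x y, |deriv ψ x - deriv ψ y| ≤ K * |x - y| := by
  have hψ' : ContDiff ℝ (⊤ : ℕ∞) (deriv ψ) := (contDiff_infty_iff_deriv.1 hψ).2
  have hψ'' : ContDiff ℝ (⊤ : ℕ∞) (deriv (deriv ψ)) := (contDiff_infty_iff_deriv.1 hψ').2
  obtain ⟨S₀, hS₀⟩ := hψc.exists_bound_of_continuous hψ.continuous
  obtain ⟨S, hS⟩ := hψc.deriv.exists_bound_of_continuous hψ'.continuous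
  obtain ⟨K, hK⟩ := hψc.deriv.deriv.exists_bound_of_continuous hψ''.continuous
  obtain ⟨R, hR0, hR⟩ := hψc.isCompact.isBounded.subset_ball_lt 0 0
  have hn : ∀ x, R ≤ |x| → x ∉ tsupport ψ := fun x hx h => by
    have := hR h
    rw [mem_ball_zero_iff, Real.norm_eq_abs] at this
    linarith
  refine ⟨R, S₀, S, K, hR0, fun x hx => image_eq_zero_of_notMem_tsupport (hn x hx),
    fun x hx => image_eq_zero_of_notMem_tsupport fun h => hn x hx (tsupport_deriv_subset h),
    hS₀, hS, fun x y => ?_⟩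
  exact convex_univ.norm_image_sub_le_of_norm_deriv_le
    (fun z _ => (hψ'.differentiable (by simp)).differentiableAt) (fun z _ => hK z)
    (mem_univ y) (mem_univ x)

/-- The rescaled kernel `h⁻¹ φ(y / h)`. -/
noncomputable def rescale (φ : ℝ → ℝ) (h y : ℝ) : ℝ := h⁻¹ * φ (y / h)

theorem contDiff_rescale {φ : ℝ → ℝ} (hφ : ContDiff ℝ (⊤ : ℕ∞) φ) (h : ℝ) :
    ContDiff ℝ 1 (rescale φ h) := by
  have h1 : ContDiff ℝ 1 φ := hφ.of_le (by exact_mod_cast le_top)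
  exact contDiff_const.mul (h1.comp (contDiff_id.div_const h))

theorem deriv_rescale {φ : ℝ → ℝ} (hφ : ContDiff ℝ (⊤ : ℕ∞) φ) (h y : ℝ) :
    deriv (rescale φ h) y = h⁻¹ * (h⁻¹ * deriv φ (y / h)) := by
  have h1 : HasDerivAt φ (deriv φ (y / h)) (y / h) :=
    (hφ.differentiable (by simp)).differentiableAt.hasDerivAt
  have h2 := (h1.comp y ((hasDerivAt_id y).div_const h)).const_mul h⁻¹
  refine HasDerivAt.deriv (h2.congr_deriv ?_)
  rw [one_div, mul_comm (deriv φ _)]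

theorem integral_abs_rescale (φ : ℝ → ℝ) {h : ℝ} (hh : 0 < h) :
    ∫ y, |rescale φ h y| = ∫ y, |φ y| := by
  simp only [rescale, abs_mul]
  rw [integral_const_mul, Measure.integral_comp_div (fun y => |φ y|), smul_eq_mul, ← mul_assoc,
    ← abs_mul, inv_mul_cancel₀ hh.ne', abs_one, one_mul]

theorem le_abs_div_of_le {ρ h y : ℝ} (hh : 0 < h) (hy : h * ρ ≤ |y|) : ρ ≤ |y / h| := by
  rwa [abs_div, abs_of_pos hh, le_div_iff₀ hh, mul_comm]

theorem tendsto_rpow_nhdsWithin_zero {c : ℝ} (hc : 0 < c) :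
    Tendsto (fun ε : ℝ => ε ^ c) (nhdsWithin 0 (Ioo 0 1)) (nhds 0) := by
  have h := (Real.continuousAt_rpow_const 0 c (Or.inr hc.le)).tendsto
  rw [Real.zero_rpow hc.ne'] at h
  exact h.mono_left nhdsWithin_le_nhds

/-- Theorem 1: provided `0 < α < 1/(n+1)` and `0 < β < α`, the family
`(u_ε, v_ε, w_ε)` is a weak asymptotic method for the system
`∂ₜu + ∂ₓ(u²) = 0`, `∂ₜv + ∂ₓ(uv) = 0`, `∂ₜw + ∂ₓ(uw) + ∂ₓ(vⁿ) = 0`: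
the tested residuals of the second and third equations tend to `0` as `ε → 0`. -/
theorem stmt6 (n : ℕ) (hn : 1 ≤ n)
    (α β : ℝ) (hα0 : 0 < α) (hα1 : α < 1 / ((n : ℝ) + 1)) (hβ : 0 < β) (hβα : β < α)
    (φ : ℝ → ℝ) (hφ : ContDiff ℝ (⊤ : ℕ∞) φ) (hφc : HasCompactSupport φ) (hφ1 : ∫ x, φ x = 1)
    (u : ℝ → ℝ → ℝ → ℝ) -- `u ε x t`
    (hu_cont : ∀ ε ∈ Ioo (0:ℝ) 1,
      ContinuousOn (fun p : ℝ × ℝ => u ε p.1 p.2) (univ ×ˢ Ici 0))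
    (hu_curve : ∀ ε ∈ Ioo (0:ℝ) 1, ∃ U : ℝ → BoundedContinuousFunction ℝ ℝ,
      ContinuousOn U (Ici 0) ∧ ∀ t ∈ Ici (0:ℝ), ∀ x : ℝ, U t x = u ε x t)
    (hu_per : ∀ ε ∈ Ioo (0:ℝ) 1, ∀ x : ℝ, ∀ t ∈ Ici (0:ℝ), u ε (x + 2*π) t = u ε x t)
    (M₁ : ℝ) (hM₁ : 0 < M₁)
    (hu_bdd : ∀ ε ∈ Ioo (0:ℝ) 1, ∀ x : ℝ, ∀ t ∈ Ici (0:ℝ), |u ε x t| ≤ M₁)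
    (hu_diff : ∀ ε ∈ Ioo (0:ℝ) 1, ∀ t ∈ Ici (0:ℝ), Differentiable ℝ (fun y => u ε y t))
    (hu_dx : ∀ δ > (0:ℝ), ∃ Cδ > (0:ℝ), ∀ ε ∈ Ioo (0:ℝ) 1, ∀ x : ℝ, ∀ t ∈ Icc (0:ℝ) δ,
      |deriv (fun y => u ε y t) x| ≤ Cδ / ε ^ β)
    (v₀ : ℝ → ℝ → ℝ) -- `v₀ ε x`
    (hv₀c : ∀ ε ∈ Ioo (0:ℝ) 1, Continuous (v₀ ε))
    (hv₀p : ∀ ε ∈ Ioo (0:ℝ) 1, ∀ x : ℝ, v₀ ε (x + 2*π) = v₀ ε x)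
    (C₀ : ℝ) (hv₀i : ∀ ε ∈ Ioo (0:ℝ) 1, (∫ x in (-π)..π, |v₀ ε x|) ≤ C₀)
    (X : ℝ → ℝ → BoundedContinuousFunction ℝ ℝ) -- `X ε t`
    (hX : ∀ ε ∈ Ioo (0:ℝ) 1, IsDiscreteTransportSol ε (u ε) (X ε))
    (hX0 : ∀ ε ∈ Ioo (0:ℝ) 1, ∀ x : ℝ, X ε 0 x = v₀ ε x)
    (hXper : ∀ ε ∈ Ioo (0:ℝ) 1, ∀ t ∈ Ici (0:ℝ), ∀ x : ℝ, X ε t (x + 2*π) = X ε t x)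
    (v : ℝ → ℝ → ℝ → ℝ) -- `v ε x t`, the mollified family
    (hv : ∀ ε ∈ Ioo (0:ℝ) 1, ∀ x t : ℝ,
      v ε x t = ∫ y, X ε t (x - y) * ((ε ^ α)⁻¹ * φ (y / ε ^ α)))
    (w₀ : ℝ → ℝ → ℝ) -- `w₀ ε x`
    (hw₀c : ∀ ε ∈ Ioo (0:ℝ) 1, Continuous (w₀ ε))
    (hw₀p : ∀ ε ∈ Ioo (0:ℝ) 1, ∀ x : ℝ, w₀ ε (x + 2*π) = w₀ ε x)
    (C₀' : ℝ) (hw₀i : ∀ ε ∈ Ioo (0:ℝ) 1, (∫ x in (-π)..π, |w₀ ε x|) ≤ C₀')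
    (w : ℝ → ℝ → BoundedContinuousFunction ℝ ℝ) -- `w ε t`
    (hw0 : ∀ ε ∈ Ioo (0:ℝ) 1, ∀ x : ℝ, w ε 0 x = w₀ ε x)
    (hwper : ∀ ε ∈ Ioo (0:ℝ) 1, ∀ t ∈ Ici (0:ℝ), ∀ x : ℝ, w ε t (x + 2*π) = w ε t x)
    (hw : ∀ ε ∈ Ioo (0:ℝ) 1, ∃ w' : ℝ → BoundedContinuousFunction ℝ ℝ,
      ContinuousOn w' (Ici 0) ∧
      (∀ t ∈ Ici (0:ℝ), HasDerivWithinAt (w ε) (w' t) (Ici 0) t) ∧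
      (∀ t ∈ Ici (0:ℝ), ∀ x : ℝ,
        w' t x = ε⁻¹ * (w ε t (x - ε) * max (u ε (x - ε) t) 0
          - w ε t x * |u ε x t| + w ε t (x + ε) * max (-(u ε (x + ε) t)) 0)
          - (n : ℝ) * (v ε x t) ^ (n - 1) * deriv (fun z => v ε z t) x))
    (ψ : ℝ → ℝ) (hψ : ContDiff ℝ (⊤ : ℕ∞) ψ) (hψc : HasCompactSupport ψ)
    (δ : ℝ) (hδ : 0 < δ) :
    Tendsto (fun ε => ∫ t in (0:ℝ)..δ, ∫ x,
        (derivWithin (fun s => v ε x s) (Ici 0) t * ψ x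
          - u ε x t * v ε x t * deriv ψ x))
      (nhdsWithin 0 (Ioo (0:ℝ) 1)) (nhds 0) ∧
    Tendsto (fun ε => ∫ t in (0:ℝ)..δ, ∫ x,
        (derivWithin (fun s => w ε s x) (Ici 0) t * ψ x
          - u ε x t * w ε t x * deriv ψ x - (v ε x t) ^ n * deriv ψ x))
      (nhdsWithin 0 (Ioo (0:ℝ) 1)) (nhds 0) := by
  have hpi := Real.pi_pos
  obtain ⟨ρ, A, B, -, hρ0, hφρ, hφρ', hA, hB, -⟩ := exists_test_function_bounds hφ hφc
  obtain ⟨R, -, S, K, hR0, hR, hR', -, hS, hK⟩ := exists_test_function_bounds hψ hψc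
  obtain ⟨Cδ, hCδ, hux⟩ := hu_dx δ hδ
  obtain ⟨m, hm⟩ : ∃ m : ℕ, R + ρ + 1 ≤ m * π := by
    obtain ⟨m, hm⟩ := exists_nat_ge ((R + ρ + 1) / π)
    exact ⟨m, (div_le_iff₀ hpi).1 hm⟩
  have hA0 : 0 ≤ A := (abs_nonneg _).trans (hA 0)
  have hB0 : 0 ≤ B := (abs_nonneg _).trans (hB 0)
  have hS0 : 0 ≤ S := (abs_nonneg _).trans (hS 0)
  have hK0 : 0 ≤ K := by simpa using (abs_nonneg _).trans (hK 1 0)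
  have hC₀ : 0 ≤ C₀ := (intervalIntegral.integral_nonneg (by linarith)
    fun _ _ => abs_nonneg _).trans (hv₀i (1 / 2) ⟨by norm_num, by norm_num⟩)
  have hψd : ∀ x, HasDerivAt ψ (deriv ψ x) x := fun x =>
    (hψ.differentiable (by simp)).differentiableAt.hasDerivAt
  have hψ'c : Continuous (deriv ψ) := hψ.continuous_deriv (by simp)
  have hhpos : ∀ ε ∈ Ioo (0 : ℝ) 1, 0 < ε ^ α := fun ε hε => Real.rpow_pos_of_pos hε.1 α
  have hhle : ∀ ε ∈ Ioo (0 : ℝ) 1, ε ^ α ≤ 1 := fun ε hε =>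
    Real.rpow_le_one hε.1.le hε.2.le hα0.le
  have hkc : ∀ ε, Continuous (rescale φ (ε ^ α)) := fun ε => (contDiff_rescale hφ _).continuous
  have hkv : ∀ ε ∈ Ioo (0 : ℝ) 1, ∀ y, ε ^ α * ρ ≤ |y| → rescale φ (ε ^ α) y = 0 :=
    fun ε hε y hy => by
      rw [rescale, hφρ _ (le_abs_div_of_le (hhpos ε hε) hy), mul_zero]
  have hkv' : ∀ ε ∈ Ioo (0 : ℝ) 1, ∀ y, ε ^ α * ρ ≤ |y| → deriv (rescale φ (ε ^ α)) y = 0 :=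
    fun ε hε y hy => by
      rw [deriv_rescale hφ, hφρ' _ (le_abs_div_of_le (hhpos ε hε) hy), mul_zero, mul_zero]
  have hhρ : ∀ ε ∈ Ioo (0 : ℝ) 1, ε ^ α * ρ ≤ ρ := fun ε hε =>
    mul_le_of_le_one_left hρ0.le (hhle ε hε)
  have hks : ∀ ε ∈ Ioo (0 : ℝ) 1, HasCompactSupport (rescale φ (ε ^ α)) := fun ε hε =>
    hasCompactSupport_of_vanish (hkv ε hε)
  have huc : ∀ ε ∈ Ioo (0 : ℝ) 1, ∀ t ∈ Ici (0 : ℝ), Continuous fun x => u ε x t :=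
    fun ε hε t ht => (hu_diff ε hε t ht).continuous
  have hve : ∀ ε ∈ Ioo (0 : ℝ) 1, ∀ t,
      (fun x => v ε x t) = fun x => ∫ y, X ε t (x - y) * rescale φ (ε ^ α) y :=
    fun ε hε t => funext fun x => hv ε hε x t
  have hXL : ∀ ε ∈ Ioo (0 : ℝ) 1, ∀ t ∈ Icc 0 δ, ∫ x in (-π)..π, |X ε t x| ≤ C₀ := by
    intro ε hε t ht
    obtain ⟨X', -, hX1, hX2⟩ := hX ε hε
    have h := integral_abs_le_of_transport (u := fun t x => u ε x t) (g := fun _ _ => 0) (G := 0)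
      hε.1 hM₁ (huc ε hε) (fun s hs x => hu_per ε hε x s hs)
      (fun s hs x => hu_bdd ε hε x s hs) (hXper ε hε) hX1
      (fun s hs x => by rw [hX2 s hs x, sub_zero, transportOp]) (by simp) ht
    simp only [hX0 ε hε] at h
    have := hv₀i ε hε
    linarith
  set G : ℝ → ℝ := fun ε => n * ((ε ^ α)⁻¹ * A * (m * C₀)) ^ (n - 1)
    * ((ε ^ α)⁻¹ * ((ε ^ α)⁻¹ * B) * (m * C₀)) with hG
  have hvb : ∀ ε ∈ Ioo (0 : ℝ) 1, ∀ t ∈ Icc 0 δ, ∀ x,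
      |v ε x t| ≤ (ε ^ α)⁻¹ * A * (m * C₀) := by
    intro ε hε t ht x
    have hh := hhpos ε hε
    rw [hv ε hε x t]
    refine (abs_mollify_le (k := rescale φ (ε ^ α)) (K := (ε ^ α)⁻¹ * A) (m := m)
      (X ε t).continuous (hXper ε hε t ht.1) (fun y => ?_) (fun y hy => hkv ε hε y ?_) x).trans ?_
    · rw [rescale, abs_mul, abs_of_pos (inv_pos.2 hh)]
      gcongr
      exact hA _
    · linarith [hhρ ε hε]
    · gcongr
      exact hXL ε hε t ht
  have hvd : ∀ ε ∈ Ioo (0 : ℝ) 1, ∀ t x, HasDerivAt (fun x => v ε x t)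
      (∫ y, X ε t (x - y) * deriv (rescale φ (ε ^ α)) y) x := by
    intro ε hε t x
    rw [hve ε hε t]
    exact hasDerivAt_mollify (X ε t).continuous (contDiff_rescale hφ _) (hks ε hε) x
  have hvdb : ∀ ε ∈ Ioo (0 : ℝ) 1, ∀ t ∈ Icc 0 δ, ∀ x,
      |deriv (fun z => v ε z t) x| ≤ (ε ^ α)⁻¹ * ((ε ^ α)⁻¹ * B) * (m * C₀) := by
    intro ε hε t ht x
    have hh := hhpos ε hε
    rw [(hvd ε hε t x).deriv]
    refine (abs_mollify_le (k := deriv (rescale φ (ε ^ α))) (K := (ε ^ α)⁻¹ * ((ε ^ α)⁻¹ * B))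
      (m := m) (X ε t).continuous (hXper ε hε t ht.1) (fun y => ?_)
      (fun y hy => hkv' ε hε y ?_) x).trans ?_
    · rw [deriv_rescale hφ, abs_mul, abs_mul, abs_of_pos (inv_pos.2 hh)]
      gcongr
      exact hB _
    · linarith [hhρ ε hε]
    · gcongr
      exact hXL ε hε t ht
  have hwL : ∀ ε ∈ Ioo (0 : ℝ) 1, ∀ t ∈ Icc 0 δ,
      ∫ x in (-π)..π, |w ε t x| ≤ C₀' + 2 * π * G ε * δ := by
    intro ε hε t ht
    have hh := hhpos ε hε
    obtain ⟨w', -, hw1, hw2⟩ := hw ε hε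
    have hG0 : 0 ≤ G ε := by positivity
    have h := integral_abs_le_of_transport (u := fun t x => u ε x t) (G := G ε)
      (g := fun t x => (n : ℝ) * (v ε x t) ^ (n - 1) * deriv (fun z => v ε z t) x)
      hε.1 hM₁ (huc ε hε) (fun s hs x => hu_per ε hε x s hs)
      (fun s hs x => hu_bdd ε hε x s hs) (hwper ε hε) hw1
      (fun s hs x => by rw [hw2 s hs x, transportOp])
      (fun s hs x => by
        simp only [hG, abs_mul, abs_pow, Nat.abs_cast]
        gcongr
        · exact hvb ε hε s hs x
        · exact hvdb ε hε s hs x) ht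
    simp only [hw0 ε hε] at h
    have h1 := hw₀i ε hε
    have h2 : 2 * π * G ε * t ≤ 2 * π * G ε * δ := by
      gcongr
      exact ht.2
    linarith
  have hud : ∀ t ∈ Icc 0 δ, UniqueDiffWithinAt ℝ (Ici (0 : ℝ)) t := fun t ht =>
    uniqueDiffOn_Ici 0 t ht.1
  constructor
  · have hb : ∀ ε ∈ Ioo (0 : ℝ) 1, ∀ t ∈ Icc 0 δ,
        ‖∫ x, (derivWithin (fun s => v ε x s) (Ici 0) t * ψ x
          - u ε x t * v ε x t * deriv ψ x)‖ ≤
        (∫ y, |φ y|) * ((ε * M₁ * K + Cδ * ε ^ (α - β) * ρ * S) * (m * C₀)) := by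
      intro ε hε t ht
      have hh := hhpos ε hε
      obtain ⟨X', -, hX1, hX2⟩ := hX ε hε
      have hX2' : ∀ x, X' t x = transportOp ε (fun x => u ε x t) (X ε t) x := fun x => by
        rw [hX2 t ht.1 x, transportOp]
      have hL : ∀ x y, |u ε x t - u ε y t| ≤ Cδ / ε ^ β * |x - y| := fun x y =>
        convex_univ.norm_image_sub_le_of_norm_deriv_le (f := fun x => u ε x t)
          (fun z _ => (hu_diff ε hε t ht.1).differentiableAt) (fun z _ => hux ε hε z t ht)
          (mem_univ y) (mem_univ x)
      have h := abs_integral_mollify_transportOp_le (m := m) hε.1 hε.2.le (huc ε hε t ht.1)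
        (X ε t).continuous (hXper ε hε t ht.1) (fun x => hu_bdd ε hε x t ht.1) hL (hkc ε)
        (hkv ε hε) hψd hψ'c hK hS hR hR' (by linarith [hhρ ε hε])
      have e : ∀ x, derivWithin (fun s => v ε x s) (Ici 0) t
          = ∫ y, transportOp ε (fun x => u ε x t) (X ε t) (x - y) * rescale φ (ε ^ α) y := by
        intro x
        simp only [← hX2']
        have := hasDerivWithinAt_integral_mul (hX1 t ht.1) (hkc ε) (hks ε hε) x
        rw [show (fun s => v ε x s) = fun r => ∫ y, X ε r (x - y) * rescale φ (ε ^ α) y from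
          funext fun s => hv ε hε x s]
        exact this.derivWithin (hud t ht)
      have e2 : ∀ x, v ε x t = ∫ y, X ε t (x - y) * rescale φ (ε ^ α) y := fun x => hv ε hε x t
      simp only [e, e2]
      refine h.trans ?_
      rw [integral_abs_rescale φ hh]
      have hpow : Cδ / ε ^ β * (ε ^ α * ρ) * S = Cδ * ε ^ (α - β) * ρ * S := by
        rw [Real.rpow_sub hε.1]
        ring
      rw [hpow]
      have := hε.1
      have := Real.rpow_pos_of_pos hε.1 (α - β)
      gcongr
      exact hXL ε hε t ht
    refine squeeze_zero_norm' (a := fun ε =>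
      (∫ y, |φ y|) * ((ε * M₁ * K + Cδ * ε ^ (α - β) * ρ * S) * (m * C₀)) * |δ - 0|) ?_ ?_
    · filter_upwards [self_mem_nhdsWithin] with ε hε
      refine intervalIntegral.norm_integral_le_of_norm_le_const fun t ht => ?_
      rw [uIoc_of_le hδ.le] at ht
      exact hb ε hε t (Ioc_subset_Icc_self ht)
    · have t1 : Tendsto (fun ε : ℝ => ε) (nhdsWithin 0 (Ioo 0 1)) (nhds 0) :=
        tendsto_id.mono_left nhdsWithin_le_nhds
      have t2 := tendsto_rpow_nhdsWithin_zero (sub_pos.2 hβα)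
      have := (((((t1.mul_const M₁).mul_const K).add
        (((t2.const_mul Cδ).mul_const ρ).mul_const S)).mul_const (m * C₀)).const_mul
          (∫ y, |φ y|)).mul_const |δ - 0|
      simpa using this
  · have hb : ∀ ε ∈ Ioo (0 : ℝ) 1, ∀ t ∈ Icc 0 δ,
        ‖∫ x, (derivWithin (fun s => w ε s x) (Ici 0) t * ψ x
          - u ε x t * w ε t x * deriv ψ x - (v ε x t) ^ n * deriv ψ x)‖ ≤
        ε * M₁ * K * (m * (C₀' + 2 * π * G ε * δ)) := by
      intro ε hε t ht
      obtain ⟨w', -, hw1, hw2⟩ := hw ε hε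
      have hq : ∀ x, HasDerivAt (fun x => v ε x t ^ n)
          ((n : ℝ) * (v ε x t) ^ (n - 1) * deriv (fun z => v ε z t) x) x := fun x => by
        rw [(hvd ε hε t x).deriv]
        exact (hvd ε hε t x).fun_pow n
      have hvc : Continuous fun x => v ε x t :=
        continuous_iff_continuousAt.2 fun x => (hvd ε hε t x).continuousAt
      have hdc : Continuous (deriv fun z => v ε z t) := by
        rw [show (deriv fun z => v ε z t) = _ from funext fun x => (hvd ε hε t x).deriv]
        exact continuous_mollify (X ε t).continuous
          ((contDiff_rescale hφ _).continuous_deriv le_rfl) (hks ε hε).deriv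
      have h := abs_integral_transportOp_source_le (m := m) hε.1 hε.2.le (huc ε hε t ht.1)
        (w ε t).continuous (hwper ε hε t ht.1) (fun x => hu_bdd ε hε x t ht.1) hq (by fun_prop)
        hψd hψ'c hK hR hR' (by linarith)
      have e : ∀ x, derivWithin (fun s => w ε s x) (Ici 0) t
          = transportOp ε (fun x => u ε x t) (w ε t) x
            - (n : ℝ) * (v ε x t) ^ (n - 1) * deriv (fun z => v ε z t) x := by
        intro x
        have h1 := (BoundedContinuousFunction.evalCLM ℝ x).hasFDerivAt.comp_hasDerivWithinAt t
          (hw1 t ht.1)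
        have h2 := h1.derivWithin (hud t ht)
        refine h2.trans ?_
        rw [transportOp]
        exact hw2 t ht.1 x
      simp only [e]
      refine h.trans ?_
      have := hε.1
      gcongr
      exact hwL ε hε t ht
    have hG' : ∀ ε ∈ Ioo (0 : ℝ) 1, ε * G ε
        = n * (A * (m * C₀)) ^ (n - 1) * (B * (m * C₀)) * ε ^ (1 - α * (n + 1)) := by
      intro ε hε
      have hh := hhpos ε hε
      have e1 : ε ^ (1 - α * (n + 1)) = ε * ((ε ^ α)⁻¹) ^ (n + 1) := by
        rw [Real.rpow_sub hε.1, Real.rpow_one, Real.rpow_mul hε.1.le, div_eq_mul_inv, inv_pow]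
        congr 2
        exact_mod_cast Real.rpow_natCast (ε ^ α) (n + 1)
      obtain ⟨j, rfl⟩ : ∃ j, n = j + 1 := ⟨n - 1, by omega⟩
      rw [e1]
      simp only [hG, Nat.add_sub_cancel, mul_pow]
      ring
    refine squeeze_zero_norm' (a := fun ε =>
      (ε * (M₁ * K * m * C₀') + n * (A * (m * C₀)) ^ (n - 1) * (B * (m * C₀))
        * ε ^ (1 - α * (n + 1)) * (M₁ * K * m * (2 * π * δ))) * |δ - 0|) ?_ ?_
    · filter_upwards [self_mem_nhdsWithin] with ε hε
      refine intervalIntegral.norm_integral_le_of_norm_le_const fun t ht => ?_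
      rw [uIoc_of_le hδ.le] at ht
      refine (hb ε hε t (Ioc_subset_Icc_self ht)).trans (le_of_eq ?_)
      rw [← hG' ε hε]
      ring
    · have t1 : Tendsto (fun ε : ℝ => ε) (nhdsWithin 0 (Ioo 0 1)) (nhds 0) :=
        tendsto_id.mono_left nhdsWithin_le_nhds
      have hexp : 0 < 1 - α * (n + 1) := by
        rw [lt_div_iff₀ (by positivity)] at hα1
        linarith
      have t2 := tendsto_rpow_nhdsWithin_zero hexp
      have := ((t1.mul_const (M₁ * K * m * C₀')).add
        ((t2.const_mul (n * (A * (m * C₀)) ^ (n - 1) * (B * (m * C₀)))).mul_const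
          (M₁ * K * m * (2 * π * δ)))).mul_const |δ - 0|
      simpa using this
end

section
/- Let ψ ∈ C_c^∞(ℝ) and let φ : ℝ → ℝ be C^∞ with compact support and ∫φ = 1. There is a constant K > 0, depending only on ψ and φ, such that for every η ∈ (0,1), every A, B > 0, every continuous function v : ℝ → ℝ with |v(x)| ≤ A for all x, and every continuous 2π-periodic function w : ℝ → ℝ with ∫_{−π}^{π}|w(x)|dx ≤ B, one has |∫∫ ((v·w)(x−y) − (v·w)(x)) φ_η(y) ψ'(x) dx dy| ≤ K·A·B·η. -/
open MeasureTheory Set Real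

/-- On a bounded interval, the integral of a continuous nonnegative `2π`-periodic function is
controlled, uniformly, by its integral over one period. -/
theorem exists_setIntegral_le_mul_of_periodic (ρ : ℝ) :
    ∃ N : ℝ, 0 ≤ N ∧ ∀ g : ℝ → ℝ, Continuous g → (∀ x, 0 ≤ g x) → Function.Periodic g (2 * π) →
      (∫ x in Icc (-ρ) ρ, g x) ≤ N * ∫ x in (-π)..π, g x := by
  obtain ⟨n, hn⟩ := exists_nat_ge (ρ / (2 * π))
  have hρ : ρ ≤ n * (2 * π) := (div_le_iff₀ two_pi_pos).1 hn
  refine ⟨2 * n, by positivity, fun g hg h0 hp => ?_⟩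
  set t : ℝ := -(n * (2 * π)) with ht
  have hnonneg : (0 : ℝ) ≤ n * (2 * π) := by positivity
  have h1 := hp.intervalIntegral_add_zsmul_eq (2 * n : ℤ) t
    (fun a b => hg.intervalIntegrable a b)
  have h2 := hp.intervalIntegral_add_eq t (-π)
  rw [show -π + 2 * π = π by ring] at h2
  rw [h2, show t + (2 * n : ℤ) • (2 * π) = n * (2 * π) by
    rw [zsmul_eq_mul]; push_cast; rw [ht]; ring, zsmul_eq_mul] at h1
  push_cast at h1
  rw [← h1, intervalIntegral.integral_of_le (by linarith), ← integral_Icc_eq_integral_Ioc]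
  exact setIntegral_mono_set (hg.integrableOn_Icc)
    (Filter.Eventually.of_forall h0) (Icc_subset_Icc (by linarith) hρ).eventuallyLE

/-- Moving a translation onto a compactly supported Lipschitz function `g`. -/
theorem abs_integral_translate_sub_mul_le {f g : ℝ → ℝ} {L : NNReal} {M R y : ℝ}
    (hf : Continuous f) (hg : LipschitzWith L g) (hM : ∀ x, M ≤ |x| → g x = 0) (hy : |y| ≤ R)
    (c : ℝ) :
    |∫ x, (f (x - y) - f x) * c * g x| ≤
      |c| * (L * |y| * ∫ x in Icc (-(M + R)) (M + R), |f x|) := by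
  have hgc : HasCompactSupport g := by
    refine HasCompactSupport.intro (isCompact_Icc (a := -M) (b := M)) fun x hx => hM x ?_
    by_contra! h
    exact hx ⟨(abs_lt.1 h).1.le, (abs_lt.1 h).2.le⟩
  have hgy : HasCompactSupport fun x => g (x + y) :=
    hgc.comp_homeomorph (Homeomorph.addRight y)
  have hi : Integrable fun x => f x * g x :=
    (hf.mul hg.continuous).integrable_of_hasCompactSupport hgc.mul_left
  have hiy : Integrable fun x => f x * g (x + y) :=
    (hf.mul (hg.continuous.comp (continuous_add_const y))).integrable_of_hasCompactSupport
      hgy.mul_left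
  have hit : Integrable fun x => f (x - y) * g x := by
    simpa using hiy.comp_sub_right y
  have htr : ∫ x, f (x - y) * g x = ∫ x, f x * g (x + y) := by
    simpa using integral_sub_right_eq_self (fun x => f x * g (x + y)) y
  have heq : ∫ x, (f (x - y) - f x) * c * g x = c * ∫ x, f x * (g (x + y) - g x) := by
    have h1 : ∀ x, (f (x - y) - f x) * c * g x = c * (f (x - y) * g x - f x * g x) :=
      fun x => by ring
    simp only [h1, mul_sub (f _)]
    rw [integral_const_mul, integral_sub hit hi, integral_sub hiy hi, htr]
  rw [heq, abs_mul]
  refine mul_le_mul_of_nonneg_left ?_ (abs_nonneg c)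
  rw [← integral_const_mul, ← integral_indicator measurableSet_Icc, ← Real.norm_eq_abs]
  refine norm_integral_le_of_norm_le ?_ (Filter.Eventually.of_forall fun x => ?_)
  · exact (integrable_indicator_iff measurableSet_Icc).2
      (continuous_const.mul hf.abs).integrableOn_Icc
  · by_cases hx : x ∈ Icc (-(M + R)) (M + R)
    · rw [indicator_of_mem hx, norm_mul, Real.norm_eq_abs, mul_comm]
      refine mul_le_mul_of_nonneg_right ?_ (abs_nonneg _)
      simpa using hg.norm_sub_le (x + y) x
    · have hlt : M + R < |x| := by
        by_contra! h
        exact hx (abs_le.1 h)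
      have hxy : |x| ≤ |x + y| + |y| := by
        simpa using abs_sub (x + y) y
      have hR : 0 ≤ R := (abs_nonneg y).trans hy
      rw [indicator_of_notMem hx, hM x (by linarith), hM (x + y) (by linarith)]
      simp

/-- A uniform mollification–commutator estimate: there is `K = K(ψ,φ)` such that for all
`η ∈ (0,1)`, all bounds `A, B > 0`, every continuous `v` with `|v| ≤ A` and every
continuous `2π`-periodic `w` with `∫_{−π}^{π}|w| ≤ B`,
`|∫∫ ((v·w)(x−y) − (v·w)(x)) φ_η(y) ψ'(x) dx dy| ≤ K·A·B·η`. -/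
theorem stmt7 (ψ φ : ℝ → ℝ)
    (hψ : ContDiff ℝ (⊤ : ℕ∞) ψ) (hψc : HasCompactSupport ψ)
    (hφ : ContDiff ℝ (⊤ : ℕ∞) φ) (hφc : HasCompactSupport φ) (hφ1 : ∫ x, φ x = 1) :
    ∃ K > (0:ℝ), ∀ η ∈ Ioo (0:ℝ) 1, ∀ A > (0:ℝ), ∀ B > (0:ℝ),
      ∀ v : ℝ → ℝ, Continuous v → (∀ x, |v x| ≤ A) →
      ∀ w : ℝ → ℝ, Continuous w → (∀ x, w (x + 2*π) = w x) →
      (∫ x in (-π)..π, |w x|) ≤ B →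
      |∫ y, ∫ x, (v (x - y) * w (x - y) - v x * w x) * (η⁻¹ * φ (y / η)) * deriv ψ x|
        ≤ K * A * B * η := by
  obtain ⟨R, hR0, hR⟩ := hφc.exists_pos_le_norm
  obtain ⟨M, hM0, hM⟩ := hψc.deriv.exists_pos_le_norm
  have hψ' : ContDiff ℝ 1 (deriv ψ) := by
    have : ContDiff ℝ (1 + 1) ψ := hψ.of_le (by norm_cast)
    exact (contDiff_succ_iff_deriv.1 this).2.2
  obtain ⟨L, hL⟩ := hψ'.lipschitzWith_of_hasCompactSupport hψc.deriv one_ne_zero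
  obtain ⟨N, hN0, hN⟩ := exists_setIntegral_le_mul_of_periodic (M + R)
  have hI : 0 ≤ ∫ z, |φ z| := integral_nonneg fun z => abs_nonneg _
  refine ⟨L * R * N * (∫ z, |φ z|) + 1, by positivity, ?_⟩
  rintro η ⟨hη, hη1⟩ A hA B hB v hv hvA w hw hwp hwB
  have hvw : ∫ x in Icc (-(M + R)) (M + R), |v x * w x| ≤ A * (N * B) := by
    calc ∫ x in Icc (-(M + R)) (M + R), |v x * w x|
        ≤ ∫ x in Icc (-(M + R)) (M + R), A * |w x| := by
          refine setIntegral_mono (hv.mul hw).abs.integrableOn_Icc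
            (continuous_const.mul hw.abs).integrableOn_Icc fun x => ?_
          simp only [abs_mul]
          exact mul_le_mul_of_nonneg_right (hvA x) (abs_nonneg _)
      _ = A * ∫ x in Icc (-(M + R)) (M + R), |w x| := integral_const_mul _ _
      _ ≤ A * (N * B) := by
          refine mul_le_mul_of_nonneg_left ?_ hA.le
          refine (hN _ hw.abs (fun x => abs_nonneg _) fun x => ?_).trans
            (mul_le_mul_of_nonneg_left hwB hN0)
          simp only [hwp x]
  have hφi : Integrable fun z => |φ z| :=
    (hφ.continuous.integrable_of_hasCompactSupport hφc).abs
  have key : |∫ y, ∫ x, (v (x - y) * w (x - y) - v x * w x) * (η⁻¹ * φ (y / η)) * deriv ψ x|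
      ≤ ∫ y, |φ (y / η)| * (η⁻¹ * (L * (R * η) * (A * (N * B)))) := by
    rw [← Real.norm_eq_abs]
    refine norm_integral_le_of_norm_le ((hφi.comp_div hη.ne').mul_const _)
      (Filter.Eventually.of_forall fun y => ?_)
    rcases le_or_gt R |y / η| with h | h
    · simp [hR _ h]
    · have hy : |y| ≤ R * η := by
        rw [abs_div, abs_of_pos hη, div_lt_iff₀ hη] at h
        exact h.le
      have hyR : |y| ≤ R := hy.trans (mul_le_of_le_one_right hR0.le hη1.le)
      rw [Real.norm_eq_abs]
      refine (abs_integral_translate_sub_mul_le (hv.mul hw) hL hM hyR _).trans ?_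
      rw [abs_mul, abs_of_pos (inv_pos.2 hη), mul_comm η⁻¹, mul_assoc]
      gcongr
      exact hvw
  rw [integral_mul_const, Measure.integral_comp_div (fun z => |φ z|) η, smul_eq_mul,
    abs_of_pos hη] at key
  refine key.trans ?_
  rw [show η * (∫ z, |φ z|) * (η⁻¹ * (L * (R * η) * (A * (N * B)))) =
    L * R * N * (∫ z, |φ z|) * A * B * η by field_simp]
  gcongr
  linarith
end
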